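/- arXiv:1709.07195 — 2 statements merged into one kernel-verified Lean document; each statement's English description precedes it below -/
import Mathlib

section
/- Let f, g, and h be nonnegative functions in S₀(ℝⁿ). Then ∫_{ℝⁿ} ∫_{ℝⁿ} f(y) g(x − y) h(x) dx dy ≤ ∫_{ℝⁿ} ∫_{ℝⁿ} f*_s(y) g*_s(x − y) h*_s(x) dx dy. -/
open MeasureTheory Set ENNReal

/-- The class `S₀(ℝⁿ)`. -/
def MemS0 {n : ℕ} (f : EuclideanSpace ℝ (Fin n) → ℝ) : Prop :=
  Measurable f ∧ ∀ y : ℝ, 0 < y → volume {x | y < |f x|} < ⊤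

/-- The nonincreasing rearrangement `f*(t) = inf{y > 0 : λ_f(y) < t}`. -/
noncomputable def rearr {n : ℕ} (f : EuclideanSpace ℝ (Fin n) → ℝ) (t : ℝ) : ℝ :=
  sInf {y : ℝ | 0 < y ∧ volume {x | y < |f x|} < ENNReal.ofReal t}

/-- `v_n = π^(n/2)/Γ(n/2 + 1)`, the volume of the `n`-dimensional unit ball. -/
noncomputable def unitBallVol (n : ℕ) : ℝ :=
  Real.pi ^ ((n : ℝ) / 2) / Real.Gamma ((n : ℝ) / 2 + 1)

/-- The spherically symmetric (Schwarz) rearrangement `f*_s(x) = f*(v_n |x|ⁿ)`. -/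
noncomputable def schwarzRearr {n : ℕ} (f : EuclideanSpace ℝ (Fin n) → ℝ)
    (x : EuclideanSpace ℝ (Fin n)) : ℝ :=
  rearr f (unitBallVol n * ‖x‖ ^ n)


/-- The measure of the set of pairs `(y, z)` with `y ∈ A`, `z ∈ B` and `y + z ∈ C`. -/
noncomputable def sumTriple {G : Type*} [Add G] [MeasureSpace G] (A B C : Set G) : ℝ≥0∞ :=
  (volume : Measure (G × G)) {p | p.1 ∈ A ∧ p.2 ∈ B ∧ p.1 + p.2 ∈ C}

section General

variable {G : Type*} [AddCommGroup G] [MeasureSpace G]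

theorem sumTriple_mono {A A' B B' C C' : Set G} (hA : A ⊆ A') (hB : B ⊆ B') (hC : C ⊆ C') :
    sumTriple A B C ≤ sumTriple A' B' C' :=
  measure_mono fun _ hp => ⟨hA hp.1, hB hp.2.1, hC hp.2.2⟩

theorem measurableSet_sumTriple [MeasurableAdd₂ G] {A B C : Set G} (hA : MeasurableSet A)
    (hB : MeasurableSet B) (hC : MeasurableSet C) :
    MeasurableSet {p : G × G | p.1 ∈ A ∧ p.2 ∈ B ∧ p.1 + p.2 ∈ C} :=
  (measurable_fst hA).inter ((measurable_snd hB).inter ((measurable_fst.add measurable_snd) hC))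

theorem sumTriple_univ_right [SFinite (volume : Measure G)] (A B : Set G) :
    sumTriple A B univ = volume A * volume B := by
  have : {p : G × G | p.1 ∈ A ∧ p.2 ∈ B ∧ p.1 + p.2 ∈ (univ : Set G)} = A ×ˢ B := by
    ext; simp
  rw [sumTriple, this, Measure.volume_eq_prod, Measure.prod_prod]

/-- Change of variables `(y, z) ↦ (y, y + z)`. -/
theorem volume_prod_neg_add [MeasurableAdd₂ G] [MeasurableNeg G] [SFinite (volume : Measure G)]
    [(volume : Measure G).IsAddLeftInvariant] {Z : Set (G × G)} (hZ : MeasurableSet Z) :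
    volume Z = ∫⁻ x, volume {y | (y, -y + x) ∈ Z} := by
  have h := measurePreserving_prod_neg_add (volume : Measure G) (volume : Measure G)
  rw [Measure.volume_eq_prod, ← h.measure_preimage hZ.nullMeasurableSet,
    Measure.prod_apply_symm (h.measurable hZ)]
  rfl

theorem sumTriple_eq_setLIntegral [MeasurableAdd₂ G] [MeasurableNeg G]
    [SFinite (volume : Measure G)] [(volume : Measure G).IsAddLeftInvariant] {A B C : Set G}
    (hA : MeasurableSet A) (hB : MeasurableSet B) (hC : MeasurableSet C) :
    sumTriple A B C = ∫⁻ x in C, volume {y | y ∈ A ∧ -y + x ∈ B} := by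
  rw [sumTriple, volume_prod_neg_add (measurableSet_sumTriple hA hB hC), ← lintegral_indicator hC]
  refine lintegral_congr fun x => ?_
  by_cases hx : x ∈ C <;> simp [hx]

/-- Equivalences preserving addition and measure preserve `sumTriple`. -/
theorem sumTriple_preimage {H : Type*} [AddCommGroup H] [MeasureSpace H] [MeasurableAdd₂ H]
    [SigmaFinite (volume : Measure G)] [SigmaFinite (volume : Measure H)] {e : G → H}
    (he : MeasurePreserving e) (hadd : ∀ x y, e (x + y) = e x + e y) {A B C : Set H}
    (hA : MeasurableSet A) (hB : MeasurableSet B) (hC : MeasurableSet C) :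
    sumTriple (e ⁻¹' A) (e ⁻¹' B) (e ⁻¹' C) = sumTriple A B C := by
  have := (he.prod he).measure_preimage (measurableSet_sumTriple hA hB hC).nullMeasurableSet
  rw [sumTriple, sumTriple, Measure.volume_eq_prod, Measure.volume_eq_prod, ← this]
  simp only [preimage, mem_ofPred_eq, hadd, Prod.map]

end General

section Line

theorem volume_setOf_volume_inter_Iio_lt_le {D : Set ℝ} (hD : MeasurableSet D) (τ : ℝ≥0∞) :
    volume {y | y ∈ D ∧ volume (D ∩ Iio y) < τ} ≤ τ := by
  have hmono : Monotone fun y => volume (D ∩ Iio y) := fun x y h =>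
    measure_mono (inter_subset_inter_right _ (Iio_subset_Iio h))
  have hm : MeasurableSet {y | y ∈ D ∧ volume (D ∩ Iio y) < τ} :=
    hD.inter (hmono.measurable measurableSet_Iio)
  rw [hm.measure_eq_iSup_isCompact]
  refine iSup₂_le fun K hK => iSup_le fun hKc => ?_
  rcases K.eq_empty_or_nonempty with rfl | hne
  · simp
  obtain ⟨c, hc⟩ := hKc.exists_isGreatest hne
  calc volume K ≤ volume (D ∩ Iic c) := measure_mono fun y hy => ⟨(hK hy).1, hc.2 hy⟩
    _ = volume (D ∩ Iio c) := measure_congr ((ae_eq_refl D).inter Iio_ae_eq_Iic.symm)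
    _ ≤ τ := (hK hc.1).2.le

theorem volume_setOf_le_volume_inter_Iio_le {D : Set ℝ} (hD : MeasurableSet D)
    (hfin : volume D ≠ ⊤) (τ : ℝ≥0∞) :
    volume {y | y ∈ D ∧ τ ≤ volume (D ∩ Iio y)} ≤ volume D - τ := by
  have hmono : Monotone fun y => volume (D ∩ Iio y) := fun x y h =>
    measure_mono (inter_subset_inter_right _ (Iio_subset_Iio h))
  have hm : MeasurableSet {y | y ∈ D ∧ τ ≤ volume (D ∩ Iio y)} :=
    hD.inter (hmono.measurable measurableSet_Ici)
  rw [hm.measure_eq_iSup_isCompact]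
  refine iSup₂_le fun K hK => iSup_le fun hKc => ?_
  rcases K.eq_empty_or_nonempty with rfl | hne
  · simp
  obtain ⟨c, hc⟩ := hKc.exists_isLeast hne
  have hτ := (hK hc.1).2
  have hτ' : τ ≠ ⊤ := ne_top_of_le_ne_top hfin (hτ.trans (measure_mono inter_subset_left))
  refine (ENNReal.cancel_of_ne hτ').le_tsub_of_add_le_right ?_
  calc volume K + τ ≤ volume (D \ Iio c) + volume (D ∩ Iio c) :=
        add_le_add (measure_mono fun y hy => ⟨(hK hy).1, not_lt.2 (hc.2 hy)⟩) hτ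
    _ = volume D := by rw [add_comm, measure_inter_add_sdiff _ measurableSet_Iio]

theorem volume_setOf_le_volume_inter_Ioi_le {D : Set ℝ} (hD : MeasurableSet D)
    (hfin : volume D ≠ ⊤) (τ : ℝ≥0∞) :
    volume {y | y ∈ D ∧ τ ≤ volume (D ∩ Ioi y)} ≤ volume D - τ := by
  have key := volume_setOf_le_volume_inter_Iio_le hD.neg
    (by rwa [Measure.measure_neg]) τ
  rw [Measure.measure_neg] at key
  refine le_trans (le_of_eq ?_) key
  rw [← Measure.measure_neg]
  congr 1
  ext y
  have : -D ∩ Iio y = -(D ∩ Ioi (-y)) := by ext; simp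
  simp only [Set.mem_neg, mem_ofPred_eq, this, Measure.measure_neg]

theorem sumTriple_real_le {A B C : Set ℝ} (hA : MeasurableSet A) (hB : MeasurableSet B)
    (hC : MeasurableSet C) (hAf : volume A ≠ ⊤) (hBf : volume B ≠ ⊤) (τ : ℝ≥0∞) :
    sumTriple A B C ≤ τ * volume C + (volume A - τ) * (volume B - τ) := by
  have hα : Measurable fun y => volume (A ∩ Iio y) := Monotone.measurable fun x y h =>
    measure_mono (inter_subset_inter_right _ (Iio_subset_Iio h))
  have hβ : Measurable fun y => volume (B ∩ Ioi y) := Antitone.measurable fun x y h =>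
    measure_mono (inter_subset_inter_right _ (Ioi_subset_Ioi h))
  set Z₁ : Set (ℝ × ℝ) := {p | p.1 ∈ A ∧ p.2 ∈ B ∧ p.1 + p.2 ∈ C} ∩
    {p | volume (A ∩ Iio p.1) < τ ∨ volume (B ∩ Ioi p.2) < τ} with hZ₁
  have hZ₁m : MeasurableSet Z₁ := (measurableSet_sumTriple hA hB hC).inter
    (((hα.comp measurable_fst) measurableSet_Iio).union
      ((hβ.comp measurable_snd) measurableSet_Iio))
  have hsub : {p : ℝ × ℝ | p.1 ∈ A ∧ p.2 ∈ B ∧ p.1 + p.2 ∈ C} ⊆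
      Z₁ ∪ {y | y ∈ A ∧ τ ≤ volume (A ∩ Iio y)} ×ˢ {y | y ∈ B ∧ τ ≤ volume (B ∩ Ioi y)} := by
    intro p hp
    by_cases h : volume (A ∩ Iio p.1) < τ ∨ volume (B ∩ Ioi p.2) < τ
    · exact Or.inl ⟨hp, h⟩
    · push Not at h
      exact Or.inr ⟨⟨hp.1, h.1⟩, hp.2.1, h.2⟩
  refine (measure_mono hsub).trans ((measure_union_le _ _).trans (add_le_add ?_ ?_))
  · rw [volume_prod_neg_add hZ₁m, ← lintegral_indicator_const hC]
    refine lintegral_mono fun x => ?_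
    by_cases hx : x ∈ C
    · rw [indicator_of_mem hx]
      have hDm : MeasurableSet {y | y ∈ A ∧ -y + x ∈ B} :=
        hA.inter ((measurable_neg.add_const x) hB)
      refine le_trans (measure_mono ?_) (volume_setOf_volume_inter_Iio_lt_le hDm τ)
      rintro y ⟨⟨hyA, hyB, -⟩, hy⟩
      refine ⟨⟨hyA, hyB⟩, ?_⟩
      rcases hy with hy | hy
      · refine lt_of_le_of_lt (measure_mono ?_) hy
        exact fun z hz => ⟨hz.1.1, hz.2⟩
      · refine lt_of_le_of_lt ?_ hy
        rw [← (Measure.measurePreserving_sub_left volume x).measure_preimage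
          (hB.inter measurableSet_Ioi).nullMeasurableSet]
        refine measure_mono fun z hz => ⟨?_, ?_⟩
        · have := hz.1.2
          rwa [neg_add_eq_sub] at this
        · have : z < y := hz.2
          simp only [mem_Ioi]
          linarith
    · simp [hZ₁, hx]
  · rw [Measure.volume_eq_prod, Measure.prod_prod]
    exact mul_le_mul' (volume_setOf_le_volume_inter_Iio_le hA hAf τ)
      (volume_setOf_le_volume_inter_Ioi_le hB hBf τ)

/-- The open interval of length `a` centred at the origin. -/
def centeredIoo (a : ℝ) : Set ℝ := Ioo (-(a / 2)) (a / 2)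

theorem volume_centeredIoo (a : ℝ) : volume (centeredIoo a) = ENNReal.ofReal a := by
  rw [centeredIoo, Real.volume_Ioo]; congr 1; ring

theorem measurableSet_centeredIoo (a : ℝ) : MeasurableSet (centeredIoo a) := measurableSet_Ioo

theorem sumTriple_centeredIoo (a b c : ℝ) :
    sumTriple (centeredIoo a) (centeredIoo b) (centeredIoo c) =
      ∫⁻ x in centeredIoo c, ENNReal.ofReal (min (min a b) ((a + b) / 2 - |x|)) := by
  rw [sumTriple_eq_setLIntegral (measurableSet_centeredIoo a) (measurableSet_centeredIoo b)
    (measurableSet_centeredIoo c)]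
  refine lintegral_congr fun x => ?_
  have : {y | y ∈ centeredIoo a ∧ -y + x ∈ centeredIoo b} =
      Ioo (max (-(a / 2)) (x - b / 2)) (min (a / 2) (x + b / 2)) := by
    ext y
    simp only [centeredIoo, mem_Ioo, mem_ofPred_eq, max_lt_iff, lt_min_iff]
    constructor
    · rintro ⟨⟨h1, h2⟩, h3, h4⟩
      refine ⟨⟨h1, ?_⟩, h2, ?_⟩ <;> linarith
    · rintro ⟨⟨h1, h2⟩, h3, h4⟩
      refine ⟨⟨h1, h3⟩, ?_, ?_⟩ <;> linarith
  rw [this, Real.volume_Ioo]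
  congr 1
  rcases abs_cases x with ⟨h, h'⟩ | ⟨h, h'⟩ <;> rw [h] <;> grind

theorem sumTriple_centeredIoo_of_le {a b c : ℝ} (h : a + b ≤ c) :
    sumTriple (centeredIoo a) (centeredIoo b) (centeredIoo c) =
      ENNReal.ofReal a * ENNReal.ofReal b := by
  rw [← volume_centeredIoo a, ← volume_centeredIoo b, ← sumTriple_univ_right]
  unfold sumTriple
  congr 1
  ext p
  simp only [centeredIoo, mem_Ioo, mem_ofPred_eq, mem_univ, and_true]
  refine ⟨fun h => ⟨h.1, h.2.1⟩, fun h' => ⟨h'.1, h'.2, ?_, ?_⟩⟩ <;> linarith [h'.1.1, h'.1.2,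
    h'.2.1, h'.2.2]

theorem exists_le_sumTriple_centeredIoo {a b c : ℝ} (ha : 0 ≤ a) (hb : 0 ≤ b) :
    ∃ τ : ℝ≥0∞, τ * ENNReal.ofReal c + (ENNReal.ofReal a - τ) * (ENNReal.ofReal b - τ) ≤
      sumTriple (centeredIoo a) (centeredIoo b) (centeredIoo c) := by
  rcases le_or_gt (a + b) c with h | h
  · exact ⟨0, by simp [sumTriple_centeredIoo_of_le h]⟩
  have main : ∀ τ : ℝ, 0 ≤ τ → τ ≤ a → τ ≤ b → c ≤ a + b - 2 * τ →
      ENNReal.ofReal τ * ENNReal.ofReal c +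
        sumTriple (centeredIoo (a - τ)) (centeredIoo (b - τ)) (centeredIoo c) ≤
      sumTriple (centeredIoo a) (centeredIoo b) (centeredIoo c) := by
    intro τ hτ hτa hτb hc
    rw [sumTriple_centeredIoo, sumTriple_centeredIoo, ← volume_centeredIoo c,
      ← setLIntegral_const, ← lintegral_add_left measurable_const]
    refine setLIntegral_mono' measurableSet_Ioo fun x hx => ?_
    have hx' : |x| < c / 2 := abs_lt.2 hx
    rw [← ENNReal.ofReal_add hτ]
    · apply ENNReal.ofReal_le_ofReal
      rw [← min_add_add_left, ← min_add_add_left]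
      apply le_of_eq
      congr 1 <;> ring_nf
    · refine le_min (le_min ?_ ?_) ?_ <;> linarith
  rcases le_or_gt ((a + b - c) / 2) (min a b) with h' | h'
  · refine ⟨ENNReal.ofReal ((a + b - c) / 2), ?_⟩
    have hτ : 0 ≤ (a + b - c) / 2 := by linarith
    have := main _ hτ (h'.trans (min_le_left _ _)) (h'.trans (min_le_right _ _)) (by linarith)
    rwa [sumTriple_centeredIoo_of_le (by linarith), ENNReal.ofReal_sub _ hτ,
      ENNReal.ofReal_sub _ hτ] at this
  · refine ⟨ENNReal.ofReal (min a b), ?_⟩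
    have := main (min a b) (le_min ha hb) (min_le_left _ _) (min_le_right _ _) (by linarith)
    refine le_trans (le_trans (le_of_eq ?_) le_self_add) this
    rcases min_choice a b with h | h <;> simp [h]

/-- The Riesz–Sobolev inequality for subsets of the line. -/
theorem sumTriple_le_centeredIoo {A B C : Set ℝ} (hA : MeasurableSet A) (hB : MeasurableSet B)
    (hC : MeasurableSet C) (hAf : volume A ≠ ⊤) (hBf : volume B ≠ ⊤) (hCf : volume C ≠ ⊤) :
    sumTriple A B C ≤ sumTriple (centeredIoo (volume A).toReal) (centeredIoo (volume B).toReal)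
      (centeredIoo (volume C).toReal) := by
  obtain ⟨τ, hτ⟩ := exists_le_sumTriple_centeredIoo (c := (volume C).toReal)
    (toReal_nonneg (a := volume A)) (toReal_nonneg (a := volume B))
  rw [ofReal_toReal hAf, ofReal_toReal hBf, ofReal_toReal hCf] at hτ
  exact (sumTriple_real_le hA hB hC hAf hBf τ).trans hτ

end Line

section Steiner

theorem centeredIoo_subset {a b : ℝ} (h : a ≤ b) : centeredIoo a ⊆ centeredIoo b :=
  Ioo_subset_Ioo (by linarith) (by linarith)

theorem volume_centeredIoo_sdiff_add_le {A : Set ℝ} (hA : MeasurableSet A) (hAf : volume A ≠ ⊤)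
    (k s : ℝ) :
    volume (centeredIoo (volume A).toReal \ centeredIoo k) +
      volume {t | t ∈ A \ centeredIoo k ∧ t + s ∈ centeredIoo k \ A} ≤
      volume (A \ centeredIoo k) := by
  set K := centeredIoo k with hK
  have hKm : MeasurableSet K := measurableSet_centeredIoo k
  have hKf : volume K ≠ ⊤ := by rw [hK, volume_centeredIoo]; exact ofReal_ne_top
  set d := volume {t | t ∈ A \ K ∧ t + s ∈ K \ A} with hd
  have hdP : d ≤ volume (A \ K) := measure_mono fun t ht => ht.1
  have hdQ : d ≤ volume (K \ A) := by
    rw [← (measurePreserving_add_right volume s).measure_preimage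
      (hKm.diff hA).nullMeasurableSet]
    exact measure_mono fun t ht => ht.2
  rcases le_total (volume A).toReal k with h | h
  · rw [sdiff_eq_empty.2 (centeredIoo_subset h), measure_empty, zero_add]
    exact hdP
  · have hI : volume (A ∩ K) ≠ ⊤ := ne_top_of_le_ne_top hAf (measure_mono inter_subset_left)
    have h1 : volume (centeredIoo (volume A).toReal \ K) = volume A - volume K := by
      rw [measure_sdiff (centeredIoo_subset h) hKm.nullMeasurableSet hKf, volume_centeredIoo,
        ofReal_toReal hAf]
    have hle : volume K ≤ volume A := by
      rw [hK, volume_centeredIoo, ← ofReal_toReal hAf]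
      exact ofReal_le_ofReal h
    have hA' : volume A = volume (A ∩ K) + volume (A \ K) :=
      (measure_inter_add_sdiff _ hKm).symm
    have hK' : volume K = volume (A ∩ K) + volume (K \ A) := by
      rw [inter_comm, measure_inter_add_sdiff _ hA]
    rw [hA', hK'] at hle
    rw [h1, hA', hK', tsub_add_eq_tsub_tsub, ENNReal.add_sub_cancel_left hI]
    calc _ ≤ volume (A \ K) - volume (K \ A) + volume (K \ A) := add_le_add le_rfl hdQ
      _ = volume (A \ K) := tsub_add_cancel_of_le ((ENNReal.add_le_add_iff_left hI).1 hle)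

variable {W : Type*} [MeasureSpace W]

/-- Steiner symmetrization with respect to the first coordinate. -/
def steiner (A : Set (ℝ × W)) : Set (ℝ × W) :=
  {p | ENNReal.ofReal (2 * |p.1|) < volume {t : ℝ | (t, p.2) ∈ A}}

theorem setOf_ofReal_two_mul_abs_lt {v : ℝ≥0∞} (hv : v ≠ ⊤) :
    {t : ℝ | ENNReal.ofReal (2 * |t|) < v} = centeredIoo v.toReal := by
  ext t
  rw [mem_ofPred_eq, ofReal_lt_iff_lt_toReal (by positivity) hv, centeredIoo, mem_Ioo, ← abs_lt]
  constructor <;> intro h <;> linarith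

theorem fiber_steiner {V : Type*} {A : Set (ℝ × V)} {v : V}
    (h : volume {t : ℝ | (t, v) ∈ A} ≠ ⊤) :
    {t : ℝ | (t, v) ∈ steiner A} = centeredIoo (volume {t : ℝ | (t, v) ∈ A}).toReal :=
  setOf_ofReal_two_mul_abs_lt h

theorem measurableSet_fiber {A : Set (ℝ × W)} (hA : MeasurableSet A) (w : W) :
    MeasurableSet {t : ℝ | (t, w) ∈ A} :=
  measurable_prodMk_right hA

theorem measurable_volume_fiber {A : Set (ℝ × W)} (hA : MeasurableSet A) :
    Measurable fun w => volume {t : ℝ | (t, w) ∈ A} :=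
  measurable_measure_prodMk_right hA

theorem measurableSet_steiner {A : Set (ℝ × W)} (hA : MeasurableSet A) :
    MeasurableSet (steiner A) :=
  measurableSet_lt (by fun_prop) ((measurable_volume_fiber hA).comp measurable_snd)

instance Prod.instMeasurableAdd₂ {M N : Type*} [Add M] [Add N] [MeasurableSpace M]
    [MeasurableSpace N] [MeasurableAdd₂ M] [MeasurableAdd₂ N] : MeasurableAdd₂ (M × N) :=
  ⟨by
    refine Measurable.prodMk ?_ ?_
    · exact (measurable_fst.comp measurable_fst).add (measurable_fst.comp measurable_snd)
    · exact (measurable_snd.comp measurable_fst).add (measurable_snd.comp measurable_snd)⟩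

variable [SFinite (volume : Measure W)]

theorem volume_eq_lintegral_fiber {A : Set (ℝ × W)} (hA : MeasurableSet A) :
    volume A = ∫⁻ w, volume {t : ℝ | (t, w) ∈ A} :=
  Measure.prod_apply_symm hA

theorem ae_volume_fiber_ne_top {A : Set (ℝ × W)} (hA : MeasurableSet A) (hAf : volume A ≠ ⊤) :
    ∀ᵐ w, volume {t : ℝ | (t, w) ∈ A} ≠ ⊤ := by
  rw [volume_eq_lintegral_fiber hA] at hAf
  exact (ae_lt_top (measurable_volume_fiber hA) hAf).mono fun _ h => h.ne

theorem volume_steiner {A : Set (ℝ × W)} (hA : MeasurableSet A) (hAf : volume A ≠ ⊤) :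
    volume (steiner A) = volume A := by
  rw [volume_eq_lintegral_fiber hA, volume_eq_lintegral_fiber (measurableSet_steiner hA)]
  refine lintegral_congr_ae ((ae_volume_fiber_ne_top hA hAf).mono fun w hw => ?_)
  simp only [fiber_steiner hw, volume_centeredIoo, ofReal_toReal hw]

theorem volume_steiner_sdiff_add_le [AddCommGroup W] [MeasurableAdd₂ W] {A K : Set (ℝ × W)}
    (hA : MeasurableSet A)
    (hAf : volume A ≠ ⊤) (hKm : MeasurableSet K)
    (hK : ∀ w, ∃ k, {t : ℝ | (t, w) ∈ K} = centeredIoo k) (s : ℝ) :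
    volume (steiner A \ K) + volume {p | p ∈ A \ K ∧ p + (s, 0) ∈ K \ A} ≤ volume (A \ K) := by
  have h1 := (measurableSet_steiner hA).diff hKm
  have h2 : MeasurableSet {p | p ∈ A \ K ∧ p + (s, 0) ∈ K \ A} :=
    (hA.diff hKm).inter ((measurable_id.add_const ((s, 0) : ℝ × W)) (hKm.diff hA))
  rw [volume_eq_lintegral_fiber h1, volume_eq_lintegral_fiber h2,
    volume_eq_lintegral_fiber (hA.diff hKm), ← lintegral_add_left (measurable_volume_fiber h1)]
  refine lintegral_mono_ae ((ae_volume_fiber_ne_top hA hAf).mono fun w hw => ?_)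
  obtain ⟨k, hk⟩ := hK w
  have key := volume_centeredIoo_sdiff_add_le (measurableSet_fiber hA w) hw k s
  rw [← fiber_steiner hw, ← hk] at key
  have hw₂ : {t : ℝ | (t, w) ∈ {p | p ∈ A \ K ∧ p + (s, 0) ∈ K \ A}} =
      {t | t ∈ {t | (t, w) ∈ A} \ {t | (t, w) ∈ K} ∧
        t + s ∈ {t | (t, w) ∈ K} \ {t | (t, w) ∈ A}} := by
    ext t; simp
  rw [hw₂]
  exact key

theorem sumTriple_eq_lintegral_fiber [AddCommGroup W] [MeasurableAdd₂ W] {A B C : Set (ℝ × W)}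
    (hA : MeasurableSet A) (hB : MeasurableSet B) (hC : MeasurableSet C) :
    sumTriple A B C = ∫⁻ w₁, ∫⁻ w₂, sumTriple {t : ℝ | (t, w₁) ∈ A} {t : ℝ | (t, w₂) ∈ B}
      {t : ℝ | (t, w₁ + w₂) ∈ C} := by
  have hZ := measurableSet_sumTriple hA hB hC
  set Z := {p : (ℝ × W) × (ℝ × W) | p.1 ∈ A ∧ p.2 ∈ B ∧ p.1 + p.2 ∈ C} with hZdef
  have hF : Measurable fun p : ℝ × W => volume {q : ℝ × W | (p, q) ∈ Z} :=
    measurable_measure_prodMk_left hZ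
  calc sumTriple A B C = ∫⁻ p : ℝ × W, volume {q : ℝ × W | (p, q) ∈ Z} :=
        Measure.prod_apply hZ
    _ = ∫⁻ w₁, ∫⁻ t₁, volume {q : ℝ × W | ((t₁, w₁), q) ∈ Z} :=
        lintegral_prod_symm' _ hF
    _ = _ := by
      refine lintegral_congr fun w₁ => ?_
      have hV : MeasurableSet {p : (ℝ × W) × ℝ | ((p.1.1, w₁), (p.2, p.1.2)) ∈ Z} :=
        hZ.preimage (by fun_prop)
      calc ∫⁻ t₁ : ℝ, volume {q : ℝ × W | ((t₁, w₁), q) ∈ Z}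
          = ∫⁻ t₁ : ℝ, ∫⁻ w₂, volume {t₂ : ℝ | ((t₁, w₁), (t₂, w₂)) ∈ Z} :=
            lintegral_congr fun t₁ => volume_eq_lintegral_fiber (measurable_prodMk_left hZ)
        _ = ∫⁻ w₂, ∫⁻ t₁ : ℝ, volume {t₂ : ℝ | ((t₁, w₁), (t₂, w₂)) ∈ Z} :=
            lintegral_lintegral_swap (measurable_measure_prodMk_left hV).aemeasurable
        _ = _ := lintegral_congr fun w₂ => by
            rw [sumTriple, Measure.volume_eq_prod, Measure.prod_apply]
            · rfl
            exact measurableSet_sumTriple (measurableSet_fiber hA w₁) (measurableSet_fiber hB w₂)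
              (measurableSet_fiber hC (w₁ + w₂))

theorem sumTriple_le_steiner [AddCommGroup W] [MeasurableAdd₂ W]
    [(volume : Measure W).IsAddLeftInvariant] {A B C : Set (ℝ × W)}
    (hA : MeasurableSet A) (hB : MeasurableSet B) (hC : MeasurableSet C)
    (hAf : volume A ≠ ⊤) (hBf : volume B ≠ ⊤) (hCf : volume C ≠ ⊤) :
    sumTriple A B C ≤ sumTriple (steiner A) (steiner B) (steiner C) := by
  rw [sumTriple_eq_lintegral_fiber hA hB hC, sumTriple_eq_lintegral_fiber
    (measurableSet_steiner hA) (measurableSet_steiner hB) (measurableSet_steiner hC)]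
  refine lintegral_mono_ae ((ae_volume_fiber_ne_top hA hAf).mono fun w₁ h₁ => ?_)
  refine lintegral_mono_ae ?_
  filter_upwards [ae_volume_fiber_ne_top hB hBf,
    (measurePreserving_add_left volume w₁).quasiMeasurePreserving.ae
      (ae_volume_fiber_ne_top hC hCf)] with w₂ h₂ h₃
  rw [fiber_steiner h₁, fiber_steiner h₂, fiber_steiner h₃]
  exact sumTriple_le_centeredIoo (measurableSet_fiber hA w₁) (measurableSet_fiber hB w₂)
    (measurableSet_fiber hC _) h₁ h₂ h₃

end Steiner

section Euclidean

variable {m : ℕ}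

/-- Prepend a coordinate. -/
noncomputable def euclideanCons (p : ℝ × (Fin m → ℝ)) : EuclideanSpace ℝ (Fin (m + 1)) :=
  WithLp.toLp 2 (Fin.cons p.1 p.2)

/-- Split off the first coordinate. -/
def euclideanUncons (x : EuclideanSpace ℝ (Fin (m + 1))) : ℝ × (Fin m → ℝ) :=
  (x 0, fun i => x i.succ)

theorem measurePreserving_euclideanUncons : MeasurePreserving (euclideanUncons (m := m)) := by
  have h := (volume_preserving_piFinSuccAbove (fun _ : Fin (m + 1) => ℝ) 0).comp
    (PiLp.volume_preserving_ofLp (Fin (m + 1)))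
  refine ⟨h.measurable, ?_⟩
  exact h.map_eq

theorem measurePreserving_euclideanCons : MeasurePreserving (euclideanCons (m := m)) := by
  have h := (PiLp.volume_preserving_toLp (Fin (m + 1))).comp
    (volume_preserving_piFinSuccAbove (fun _ : Fin (m + 1) => ℝ) 0).symm
  have heq : euclideanCons (m := m) = WithLp.toLp 2 ∘
      (MeasurableEquiv.piFinSuccAbove (fun _ : Fin (m + 1) => ℝ) 0).symm := by
    funext p
    simp [euclideanCons, MeasurableEquiv.piFinSuccAbove, Fin.insertNthEquiv]
  rw [heq]
  exact h

theorem euclideanCons_add (p q : ℝ × (Fin m → ℝ)) :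
    euclideanCons (p + q) = euclideanCons p + euclideanCons q := by
  ext i
  refine Fin.cases ?_ (fun j => ?_) i <;> simp [euclideanCons]

theorem euclideanUncons_add (x y : EuclideanSpace ℝ (Fin (m + 1))) :
    euclideanUncons (x + y) = euclideanUncons x + euclideanUncons y := rfl

theorem norm_euclideanCons_sq (p : ℝ × (Fin m → ℝ)) :
    ‖euclideanCons p‖ ^ 2 = p.1 ^ 2 + ∑ i, p.2 i ^ 2 := by
  simp [EuclideanSpace.norm_sq_eq, Fin.sum_univ_succ, euclideanCons]

theorem fiber_preimage_ball (r : ℝ) (w : Fin m → ℝ) :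
    ∃ k, {t : ℝ | (t, w) ∈ euclideanCons ⁻¹' Metric.ball 0 r} = centeredIoo k := by
  refine ⟨2 * √(max r 0 ^ 2 - ∑ i, w i ^ 2), ?_⟩
  ext t
  have h1 : ‖euclideanCons (t, w)‖ < r ↔ ‖euclideanCons (t, w)‖ ^ 2 < max r 0 ^ 2 := by
    rw [sq_lt_sq₀ (norm_nonneg _) (le_max_right _ _), lt_max_iff]
    simp [(norm_nonneg (euclideanCons (t, w))).not_gt]
  rw [mem_ofPred_eq, mem_preimage, mem_ball_zero_iff, h1, norm_euclideanCons_sq, centeredIoo,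
    mul_div_cancel_left₀ _ two_ne_zero, mem_Ioo, ← abs_lt, Real.lt_sqrt (abs_nonneg _), sq_abs]
  exact lt_sub_iff_add_lt.symm

/-- Steiner symmetrization of a set in Euclidean space along the first coordinate axis. -/
def euclideanSteiner (A : Set (EuclideanSpace ℝ (Fin (m + 1)))) :
    Set (EuclideanSpace ℝ (Fin (m + 1))) :=
  euclideanUncons ⁻¹' steiner (euclideanCons ⁻¹' A)

theorem euclideanCons_preimage_euclideanSteiner (A : Set (EuclideanSpace ℝ (Fin (m + 1)))) :
    euclideanCons ⁻¹' euclideanSteiner A = steiner (euclideanCons ⁻¹' A) := rfl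

theorem measurableSet_euclideanSteiner {A : Set (EuclideanSpace ℝ (Fin (m + 1)))}
    (hA : MeasurableSet A) : MeasurableSet (euclideanSteiner A) :=
  measurePreserving_euclideanUncons.measurable
    (measurableSet_steiner (measurePreserving_euclideanCons.measurable hA))

theorem volume_euclideanCons_preimage {A : Set (EuclideanSpace ℝ (Fin (m + 1)))}
    (hA : MeasurableSet A) : volume (euclideanCons ⁻¹' A) = volume A :=
  measurePreserving_euclideanCons.measure_preimage hA.nullMeasurableSet

theorem volume_euclideanSteiner {A : Set (EuclideanSpace ℝ (Fin (m + 1)))}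
    (hA : MeasurableSet A) (hAf : volume A ≠ ⊤) : volume (euclideanSteiner A) = volume A := by
  rw [← volume_euclideanCons_preimage (measurableSet_euclideanSteiner hA),
    euclideanCons_preimage_euclideanSteiner, volume_steiner
      (measurePreserving_euclideanCons.measurable hA) (by rwa [volume_euclideanCons_preimage hA]),
    volume_euclideanCons_preimage hA]

theorem volume_euclideanSteiner_sdiff_add_le {A : Set (EuclideanSpace ℝ (Fin (m + 1)))}
    (hA : MeasurableSet A) (hAf : volume A ≠ ⊤) (r s : ℝ) :
    volume (euclideanSteiner A \ Metric.ball 0 r) +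
      volume {x | x ∈ A \ Metric.ball 0 r ∧
        x + EuclideanSpace.single 0 s ∈ Metric.ball 0 r \ A} ≤
      volume (A \ Metric.ball 0 r) := by
  have hK : MeasurableSet (Metric.ball (0 : EuclideanSpace ℝ (Fin (m + 1))) r) :=
    measurableSet_ball
  have hφ := measurePreserving_euclideanCons (m := m)
  have h2 : MeasurableSet {x | x ∈ A \ Metric.ball 0 r ∧
        x + EuclideanSpace.single 0 s ∈ Metric.ball 0 r \ A} :=
    (hA.diff hK).inter ((measurable_id.add_const (EuclideanSpace.single 0 s)) (hK.diff hA))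
  have hs : EuclideanSpace.single 0 s = euclideanCons (m := m) (s, 0) := by
    ext i
    refine Fin.cases ?_ (fun j => ?_) i <;> simp [euclideanCons]
  rw [← volume_euclideanCons_preimage ((measurableSet_euclideanSteiner hA).diff hK),
    ← volume_euclideanCons_preimage h2, ← volume_euclideanCons_preimage (hA.diff hK)]
  have key := volume_steiner_sdiff_add_le (hφ.measurable hA)
    (by rwa [volume_euclideanCons_preimage hA]) (hφ.measurable hK) (fiber_preimage_ball r) s
  simp only [preimage_ofPred_eq, hs]
  simpa only [preimage_sdiff, euclideanCons_preimage_euclideanSteiner, mem_sdiff, mem_preimage,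
    euclideanCons_add] using key

theorem sumTriple_le_euclideanSteiner {A B C : Set (EuclideanSpace ℝ (Fin (m + 1)))}
    (hA : MeasurableSet A) (hB : MeasurableSet B) (hC : MeasurableSet C)
    (hAf : volume A ≠ ⊤) (hBf : volume B ≠ ⊤) (hCf : volume C ≠ ⊤) :
    sumTriple A B C ≤
      sumTriple (euclideanSteiner A) (euclideanSteiner B) (euclideanSteiner C) := by
  have hφ := measurePreserving_euclideanCons (m := m)
  have hA' := hφ.measurable hA
  have hB' := hφ.measurable hB
  have hC' := hφ.measurable hC
  rw [← volume_euclideanCons_preimage hA] at hAf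
  rw [← volume_euclideanCons_preimage hB] at hBf
  rw [← volume_euclideanCons_preimage hC] at hCf
  rw [← sumTriple_preimage hφ euclideanCons_add hA hB hC]
  refine (sumTriple_le_steiner hA' hB' hC' hAf hBf hCf).trans_eq ?_
  exact (sumTriple_preimage measurePreserving_euclideanUncons euclideanUncons_add
    (measurableSet_steiner hA') (measurableSet_steiner hB') (measurableSet_steiner hC')).symm

theorem exists_linearIsometryEquiv_apply_eq {F : Type*} [NormedAddCommGroup F]
    [InnerProductSpace ℝ F] {v w : F} (h : ‖v‖ = ‖w‖) : ∃ ρ : F ≃ₗᵢ[ℝ] F, ρ v = w :=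
  ⟨_, Submodule.reflection_sub h⟩

/-- For every vector `z` there is a volume-preserving symmetrization of sets increasing
`sumTriple`, for which the gain of overlap with centred balls is controlled by translation
by `z`. -/
theorem exists_symmetrization (z : EuclideanSpace ℝ (Fin (m + 1))) :
    ∃ S : Set (EuclideanSpace ℝ (Fin (m + 1))) → Set (EuclideanSpace ℝ (Fin (m + 1))),
      (∀ A, MeasurableSet A → volume A ≠ ⊤ → MeasurableSet (S A) ∧ volume (S A) = volume A ∧
        ∀ r, volume (S A \ Metric.ball 0 r) +
          volume {x | x ∈ A \ Metric.ball 0 r ∧ x + z ∈ Metric.ball 0 r \ A} ≤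
            volume (A \ Metric.ball 0 r)) ∧
      ∀ A B C, MeasurableSet A → MeasurableSet B → MeasurableSet C →
        volume A ≠ ⊤ → volume B ≠ ⊤ → volume C ≠ ⊤ →
        sumTriple A B C ≤ sumTriple (S A) (S B) (S C) := by
  obtain ⟨ρ, hρ⟩ := exists_linearIsometryEquiv_apply_eq
    (v := EuclideanSpace.single (0 : Fin (m + 1)) ‖z‖) (w := z) (by simp)
  have hρm : MeasurePreserving ρ := ρ.measurePreserving
  have hvol : ∀ A, MeasurableSet A → volume (ρ ⁻¹' A) = volume A := fun A hA =>
    hρm.measure_preimage hA.nullMeasurableSet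
  have hball : ∀ r, ρ ⁻¹' Metric.ball 0 r = Metric.ball 0 r := fun r => by
    ext x; simp
  refine ⟨fun A => euclideanSteiner (ρ ⁻¹' A), fun A hA hAf => ?_,
    fun A B C hA hB hC hAf hBf hCf => ?_⟩
  · have hA' := hρm.measurable hA
    have hAf' : volume (ρ ⁻¹' A) ≠ ⊤ := by rwa [hvol A hA]
    refine ⟨measurableSet_euclideanSteiner hA', ?_, fun r => ?_⟩
    · rw [volume_euclideanSteiner hA' hAf', hvol A hA]
    · have key := volume_euclideanSteiner_sdiff_add_le hA' hAf' r ‖z‖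
      have hK : MeasurableSet (Metric.ball (0 : EuclideanSpace ℝ (Fin (m + 1))) r) :=
        measurableSet_ball
      have h2 : MeasurableSet {x | x ∈ A \ Metric.ball 0 r ∧ x + z ∈ Metric.ball 0 r \ A} :=
        (hA.diff hK).inter ((measurable_id.add_const z) (hK.diff hA))
      rw [← hvol _ h2, ← hvol _ (hA.diff hK)]
      have : {x | x ∈ ρ ⁻¹' A \ Metric.ball 0 r ∧
          x + EuclideanSpace.single 0 ‖z‖ ∈ Metric.ball 0 r \ ρ ⁻¹' A} =
          ρ ⁻¹' {x | x ∈ A \ Metric.ball 0 r ∧ x + z ∈ Metric.ball 0 r \ A} := by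
        have hmem : ∀ y, y ∈ Metric.ball 0 r ↔ ρ y ∈ Metric.ball 0 r := fun y => by simp
        ext x
        have hx := hmem (x + EuclideanSpace.single 0 ‖z‖)
        rw [map_add, hρ] at hx
        simp only [mem_ofPred_eq, mem_sdiff, mem_preimage, map_add, hρ, hmem x, hx]
      rw [this] at key
      rwa [preimage_sdiff, hball]
  · rw [← sumTriple_preimage hρm (map_add ρ) hA hB hC]
    rw [← hvol A hA] at hAf
    rw [← hvol B hB] at hBf
    rw [← hvol C hC] at hCf
    exact sumTriple_le_euclideanSteiner (hρm.measurable hA) (hρm.measurable hB)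
      (hρm.measurable hC) hAf hBf hCf

end Euclidean

section Iteration

theorem volume_mul_volume_le_of_translate {E : Type*} [NormedAddCommGroup E] [MeasureSpace E]
    [BorelSpace E] [MeasurableAdd₂ E] [SFinite (volume : Measure E)]
    [(volume : Measure E).IsAddLeftInvariant] {P Q : Set E} (hP : MeasurableSet P)
    (hQ : MeasurableSet Q) {R : ℝ} (hPR : volume (P \ Metric.ball 0 R) = 0)
    (hQR : Q ⊆ Metric.ball 0 R) {c : ℝ≥0∞}
    (hc : ∀ z, volume {x | x ∈ P ∧ x + z ∈ Q} ≤ c) :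
    volume P * volume Q ≤ c * volume (Metric.ball (0 : E) (2 * R)) := by
  set P' := P ∩ Metric.ball 0 R with hP'
  have hP'm : MeasurableSet P' := hP.inter measurableSet_ball
  have hPP' : volume P = volume P' := by
    rw [← measure_inter_add_sdiff P (measurableSet_ball (x := (0 : E)) (ε := R)), hPR, add_zero]
  have hmp := measurePreserving_prod_add (volume : Measure E) (volume : Measure E)
  rw [hPP', ← Measure.prod_prod, ← hmp.measure_preimage (hP'm.prod hQ).nullMeasurableSet,
    Measure.prod_apply_symm (hmp.measurable (hP'm.prod hQ)),
    ← lintegral_indicator_const measurableSet_ball]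
  refine lintegral_mono fun z => ?_
  by_cases hz : z ∈ Metric.ball (0 : E) (2 * R)
  · rw [indicator_of_mem hz]
    refine le_trans (measure_mono ?_) (hc z)
    exact fun x hx => ⟨hx.1.1, hx.2⟩
  · rw [indicator_of_notMem hz, nonpos_iff_eq_zero]
    refine measure_mono_null ?_ (measure_empty (μ := (volume : Measure E)))
    rintro x ⟨hx1, hx2⟩
    refine hz ?_
    have h1 := mem_ball_zero_iff.1 hx1.2
    have h2 := mem_ball_zero_iff.1 (hQR hx2)
    rw [mem_ball_zero_iff]
    calc ‖z‖ = ‖(x + z) - x‖ := by rw [add_sub_cancel_left]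
      _ ≤ ‖x + z‖ + ‖x‖ := norm_sub_le _ _
      _ < 2 * R := by simp only at h2; linarith

theorem sumTriple_le_add_sdiff {G : Type*} [AddCommGroup G] [MeasureSpace G] [MeasurableAdd₂ G]
    [SFinite (volume : Measure G)] [(volume : Measure G).IsAddLeftInvariant]
    {A B C C' : Set G} (hA : MeasurableSet A) (hC : MeasurableSet C) (hC' : MeasurableSet C')
    (A' B' : Set G) :
    sumTriple A B C ≤ sumTriple A' B' C' + (volume (A \ A') * volume B +
      volume A * volume (B \ B') + volume A * volume (C \ C')) := by
  have hmp := measurePreserving_prod_add (volume : Measure G) (volume : Measure G)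
  have hD := hA.prod (hC.diff hC')
  rw [← Measure.prod_prod, ← Measure.prod_prod, ← Measure.prod_prod (s := A) (t := C \ C'),
    ← hmp.measure_preimage hD.nullMeasurableSet]
  unfold sumTriple
  refine le_trans (measure_mono (t := _ ∪ (_ ∪ _ ∪ _)) ?_) ((measure_union_le _ _).trans
    (add_le_add le_rfl ((measure_union_le _ _).trans
      (add_le_add (measure_union_le _ _) le_rfl))))
  rintro p ⟨h1, h2, h3⟩
  by_cases hA : p.1 ∈ A'
  · by_cases hB : p.2 ∈ B'
    · by_cases hC : p.1 + p.2 ∈ C'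
      · exact Or.inl ⟨hA, hB, hC⟩
      · exact Or.inr (Or.inr ⟨h1, h3, hC⟩)
    · exact Or.inr (Or.inl (Or.inr ⟨h1, h2, hB⟩))
  · exact Or.inr (Or.inl (Or.inl ⟨⟨h1, hA⟩, h2⟩))

variable {m : ℕ}

/-- `A` is measurable, has the volume of the centred ball of radius `r ≤ R`, and is essentially
contained in the centred ball of radius `R`. -/
structure EssBounded (R r : ℝ) (A : Set (EuclideanSpace ℝ (Fin m))) : Prop where
  measurableSet : MeasurableSet A
  volume_eq : volume A = volume (Metric.ball (0 : EuclideanSpace ℝ (Fin m)) r)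
  volume_sdiff : volume (A \ Metric.ball 0 R) = 0
  le : r ≤ R

namespace EssBounded

variable {R r : ℝ} {A : Set (EuclideanSpace ℝ (Fin m))}

theorem volume_ne_top (h : EssBounded R r A) : volume A ≠ ⊤ := by
  rw [h.volume_eq]; exact measure_ball_lt_top.ne

theorem exists_lt_volume_translate (h : EssBounded R r A) {c η : ℝ≥0∞}
    (hη : η ≤ volume (A \ Metric.ball 0 r))
    (hc : c * volume (Metric.ball (0 : EuclideanSpace ℝ (Fin m)) (2 * R)) < η * η) :
    ∃ z, c < volume {x | x ∈ A \ Metric.ball 0 r ∧ x + z ∈ Metric.ball 0 r \ A} := by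
  by_contra! hcon
  have hK : MeasurableSet (Metric.ball (0 : EuclideanSpace ℝ (Fin m)) r) := measurableSet_ball
  have key := volume_mul_volume_le_of_translate (h.measurableSet.diff hK)
    (hK.diff h.measurableSet)
    (measure_mono_null (sdiff_subset_sdiff_left sdiff_subset) h.volume_sdiff)
    (sdiff_subset.trans (Metric.ball_subset_ball h.le)) hcon
  have hQ : volume (A \ Metric.ball 0 r) = volume (Metric.ball 0 r \ A) := by
    have h1 := measure_inter_add_sdiff (μ := volume) A hK
    have h2 := measure_inter_add_sdiff (μ := volume)
      (Metric.ball (0 : EuclideanSpace ℝ (Fin m)) r) h.measurableSet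
    rw [← h.volume_eq, ← h1, inter_comm] at h2
    refine ((ENNReal.add_right_inj ?_).1 h2).symm
    exact ne_top_of_le_ne_top h.volume_ne_top (measure_mono inter_subset_left)
  rw [← hQ] at key
  exact absurd (hc.trans_le ((mul_le_mul' hη hη).trans key)) (lt_irrefl _)

end EssBounded

theorem sumTriple_le_ball_add_of_sdiff_le {R a b c : ℝ} {η : ℝ≥0∞}
    {A B C : Set (EuclideanSpace ℝ (Fin m))}
    (hA : EssBounded R a A) (hC : EssBounded R c C)
    (h1 : volume (A \ Metric.ball 0 a) ≤ η) (h2 : volume (B \ Metric.ball 0 b) ≤ η)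
    (h3 : volume (C \ Metric.ball 0 c) ≤ η) :
    sumTriple A B C ≤ sumTriple (Metric.ball (0 : EuclideanSpace ℝ (Fin m)) a) (Metric.ball 0 b) (Metric.ball 0 c) +
      η * (volume B + volume A + volume A) := by
  refine (sumTriple_le_add_sdiff hA.measurableSet hC.measurableSet measurableSet_ball
    (Metric.ball 0 a) (Metric.ball 0 b)).trans (add_le_add le_rfl ?_)
  rw [mul_add, mul_add, mul_comm (volume A), mul_comm (volume A)]
  gcongr

/-- Repeated symmetrization brings three sets close to balls. -/
theorem sumTriple_le_ball_add {R a b c : ℝ} {η δ : ℝ≥0∞}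
    (hδ : δ * volume (Metric.ball (0 : EuclideanSpace ℝ (Fin (m + 1))) (2 * R)) < η * η) (N : ℕ)
    (A B C : Set (EuclideanSpace ℝ (Fin (m + 1))))
    (hA : EssBounded R a A) (hB : EssBounded R b B) (hC : EssBounded R c C)
    (hN : volume (A \ Metric.ball 0 a) + volume (B \ Metric.ball 0 b) +
      volume (C \ Metric.ball 0 c) ≤ N * δ) :
    sumTriple A B C ≤ sumTriple (Metric.ball (0 : EuclideanSpace ℝ (Fin (m + 1))) a) (Metric.ball 0 b) (Metric.ball 0 c) +
      η * (volume B + volume A + volume A) := by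
  induction N generalizing A B C with
  | zero =>
    simp only [Nat.cast_zero, zero_mul, nonpos_iff_eq_zero, add_eq_zero] at hN
    exact sumTriple_le_ball_add_of_sdiff_le hA hC (by simp [hN]) (by simp [hN]) (by simp [hN])
  | succ N ih =>
    by_cases hall : volume (A \ Metric.ball 0 a) ≤ η ∧ volume (B \ Metric.ball 0 b) ≤ η ∧
        volume (C \ Metric.ball 0 c) ≤ η
    · exact sumTriple_le_ball_add_of_sdiff_le hA hC hall.1 hall.2.1 hall.2.2
    have hz : ∃ z, δ ≤ volume {x | x ∈ A \ Metric.ball 0 a ∧ x + z ∈ Metric.ball 0 a \ A} +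
        volume {x | x ∈ B \ Metric.ball 0 b ∧ x + z ∈ Metric.ball 0 b \ B} +
        volume {x | x ∈ C \ Metric.ball 0 c ∧ x + z ∈ Metric.ball 0 c \ C} := by
      simp only [not_and_or, not_le] at hall
      rcases hall with h | h | h
      · obtain ⟨z, hz⟩ := hA.exists_lt_volume_translate h.le hδ
        exact ⟨z, hz.le.trans (le_self_add.trans le_self_add)⟩
      · obtain ⟨z, hz⟩ := hB.exists_lt_volume_translate h.le hδ
        exact ⟨z, hz.le.trans (le_add_self.trans le_self_add)⟩
      · obtain ⟨z, hz⟩ := hC.exists_lt_volume_translate h.le hδ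
        exact ⟨z, hz.le.trans le_add_self⟩
    obtain ⟨z, hz⟩ := hz
    obtain ⟨S, hS, hST⟩ := exists_symmetrization z
    have hSb : ∀ {r D}, EssBounded R r D → EssBounded R r (S D) := fun {r D} hD => by
      obtain ⟨h1, h2, h3⟩ := hS D hD.measurableSet hD.volume_ne_top
      refine ⟨h1, h2.trans hD.volume_eq, ?_, hD.le⟩
      exact nonpos_iff_eq_zero.1 ((le_self_add.trans (h3 R)).trans hD.volume_sdiff.le)
    have hδ' : δ ≠ ⊤ := by
      refine ne_top_of_le_ne_top ?_ hz
      refine add_ne_top.2 ⟨add_ne_top.2 ⟨?_, ?_⟩, ?_⟩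
      · exact ne_top_of_le_ne_top hA.volume_ne_top (measure_mono fun x hx => hx.1.1)
      · exact ne_top_of_le_ne_top hB.volume_ne_top (measure_mono fun x hx => hx.1.1)
      · exact ne_top_of_le_ne_top hC.volume_ne_top (measure_mono fun x hx => hx.1.1)
    have hA' := hS A hA.measurableSet hA.volume_ne_top
    have hB' := hS B hB.measurableSet hB.volume_ne_top
    have hC' := hS C hC.measurableSet hC.volume_ne_top
    have hN' : volume (S A \ Metric.ball 0 a) + volume (S B \ Metric.ball 0 b) +
        volume (S C \ Metric.ball 0 c) ≤ N * δ := by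
      refine (ENNReal.add_le_add_iff_right hδ').1 ?_
      rw [Nat.cast_succ, add_mul, one_mul] at hN
      refine le_trans ?_ hN
      refine (add_le_add le_rfl hz).trans (le_trans (le_of_eq ?_)
        (add_le_add (add_le_add (hA'.2.2 a) (hB'.2.2 b)) (hC'.2.2 c)))
      ring
    refine (hST A B C hA.measurableSet hB.measurableSet hC.measurableSet hA.volume_ne_top
      hB.volume_ne_top hC.volume_ne_top).trans ?_
    rw [← hA'.2.1, ← hB'.2.1]
    refine ih _ _ _ (hSb hA) (hSb hB) (hSb hC) hN'

theorem sumTriple_le_ball_of_essBounded {R a b c : ℝ}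
    {A B C : Set (EuclideanSpace ℝ (Fin (m + 1)))}
    (hA : EssBounded R a A) (hB : EssBounded R b B) (hC : EssBounded R c C) :
    sumTriple A B C ≤ sumTriple (Metric.ball (0 : EuclideanSpace ℝ (Fin (m + 1))) a) (Metric.ball 0 b) (Metric.ball 0 c) := by
  refine ENNReal.le_of_forall_pos_le_add fun ε hε _ => ?_
  have hM : volume B + volume A + volume A ≠ ⊤ :=
    add_ne_top.2 ⟨add_ne_top.2 ⟨hB.volume_ne_top, hA.volume_ne_top⟩, hA.volume_ne_top⟩
  obtain ⟨η, hη, hηM⟩ := ENNReal.exists_nnreal_pos_mul_lt hM (coe_ne_zero.2 hε.ne')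
  have hη' : (η : ℝ≥0∞) * η ≠ 0 := mul_ne_zero (coe_ne_zero.2 hη.ne') (coe_ne_zero.2 hη.ne')
  obtain ⟨δ, hδ, hδV⟩ := ENNReal.exists_nnreal_pos_mul_lt
    (measure_ball_lt_top (μ := (volume : Measure (EuclideanSpace ℝ (Fin (m + 1)))))
      (x := 0) (r := 2 * R)).ne hη'
  obtain ⟨N, hN⟩ := ENNReal.exists_nat_mul_gt (coe_ne_zero.2 hδ.ne')
    (b := volume (A \ Metric.ball 0 a) + volume (B \ Metric.ball 0 b) +
      volume (C \ Metric.ball 0 c)) (by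
    refine add_ne_top.2 ⟨add_ne_top.2 ⟨?_, ?_⟩, ?_⟩
    · exact ne_top_of_le_ne_top hA.volume_ne_top (measure_mono sdiff_subset)
    · exact ne_top_of_le_ne_top hB.volume_ne_top (measure_mono sdiff_subset)
    · exact ne_top_of_le_ne_top hC.volume_ne_top (measure_mono sdiff_subset))
  exact (sumTriple_le_ball_add hδV N A B C hA hB hC hN.le).trans (add_le_add le_rfl hηM.le)

end Iteration

section Balls

variable {m : ℕ}

theorem unitBallVol_pos (n : ℕ) : 0 < unitBallVol n :=
  div_pos (Real.rpow_pos_of_pos Real.pi_pos _) (Real.Gamma_pos_of_pos (by positivity))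

theorem volume_ball_eq_unitBallVol (r : ℝ) (hr : 0 ≤ r) :
    volume (Metric.ball (0 : EuclideanSpace ℝ (Fin (m + 1))) r) =
      ENNReal.ofReal (unitBallVol (m + 1) * r ^ (m + 1)) := by
  rw [EuclideanSpace.volume_ball, Fintype.card_fin, ← ENNReal.ofReal_pow hr,
    ← ENNReal.ofReal_mul (by positivity), mul_comm, unitBallVol, Real.sqrt_eq_rpow,
    ← Real.rpow_mul_natCast Real.pi_pos.le]
  congr 4
  ring

/-- The centred open ball with the same volume as `A`. -/
def symmetricBall {n : ℕ} (A : Set (EuclideanSpace ℝ (Fin n))) :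
    Set (EuclideanSpace ℝ (Fin n)) :=
  {x | ENNReal.ofReal (unitBallVol n * ‖x‖ ^ n) < volume A}

theorem symmetricBall_mono {n : ℕ} {A B : Set (EuclideanSpace ℝ (Fin n))} (h : A ⊆ B) :
    symmetricBall A ⊆ symmetricBall B :=
  fun _ hx => lt_of_lt_of_le hx (measure_mono h)

theorem exists_symmetricBall_eq_ball {A : Set (EuclideanSpace ℝ (Fin (m + 1)))}
    (hA : volume A ≠ ⊤) :
    ∃ r, symmetricBall A = Metric.ball 0 r ∧
      volume A = volume (Metric.ball (0 : EuclideanSpace ℝ (Fin (m + 1))) r) := by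
  have hu := unitBallVol_pos (m + 1)
  set v := (volume A).toReal with hv
  have hv0 : 0 ≤ v / unitBallVol (m + 1) := div_nonneg toReal_nonneg hu.le
  set r := (v / unitBallVol (m + 1)) ^ ((↑(m + 1) : ℝ)⁻¹) with hr
  have hr0 : 0 ≤ r := Real.rpow_nonneg hv0 _
  have hrv : unitBallVol (m + 1) * r ^ (m + 1) = v := by
    rw [hr, Real.rpow_inv_natCast_pow hv0 (Nat.succ_ne_zero m)]
    field_simp
  refine ⟨r, ?_, ?_⟩
  · ext x
    rw [symmetricBall, mem_ofPred_eq, ofReal_lt_iff_lt_toReal (by positivity) hA, ← hv, ← hrv,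
      mul_lt_mul_iff_right₀ hu, pow_lt_pow_iff_left₀ (norm_nonneg _) hr0 (Nat.succ_ne_zero m),
      mem_ball_zero_iff]
  · rw [volume_ball_eq_unitBallVol r hr0, hrv, hv, ofReal_toReal hA]

theorem sumTriple_le_symmetricBall_of_subset_ball {A B C : Set (EuclideanSpace ℝ (Fin (m + 1)))}
    (hA : MeasurableSet A) (hB : MeasurableSet B) (hC : MeasurableSet C) {R : ℝ}
    (hAR : A ⊆ Metric.ball 0 R) (hBR : B ⊆ Metric.ball 0 R) (hCR : C ⊆ Metric.ball 0 R) :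
    sumTriple A B C ≤ sumTriple (symmetricBall A) (symmetricBall B) (symmetricBall C) := by
  have hfin : ∀ {D : Set (EuclideanSpace ℝ (Fin (m + 1)))}, D ⊆ Metric.ball 0 R →
      volume D ≠ ⊤ := fun hD => ne_top_of_le_ne_top measure_ball_lt_top.ne (measure_mono hD)
  obtain ⟨a, ha, hav⟩ := exists_symmetricBall_eq_ball (hfin hAR)
  obtain ⟨b, hb, hbv⟩ := exists_symmetricBall_eq_ball (hfin hBR)
  obtain ⟨c, hc, hcv⟩ := exists_symmetricBall_eq_ball (hfin hCR)
  have hnull : ∀ {D : Set (EuclideanSpace ℝ (Fin (m + 1)))}, D ⊆ Metric.ball 0 R →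
      volume (D \ Metric.ball 0 (max R (max a (max b c)))) = 0 := fun hD => by
    rw [sdiff_eq_empty.2 (hD.trans (Metric.ball_subset_ball (le_max_left _ _))), measure_empty]
  rw [ha, hb, hc]
  exact sumTriple_le_ball_of_essBounded (R := max R (max a (max b c)))
    ⟨hA, hav, hnull hAR, by simp⟩ ⟨hB, hbv, hnull hBR, by simp⟩ ⟨hC, hcv, hnull hCR, by simp⟩

/-- The Riesz–Sobolev inequality for measurable sets. -/
theorem sumTriple_le_symmetricBall {A B C : Set (EuclideanSpace ℝ (Fin (m + 1)))}
    (hA : MeasurableSet A) (hB : MeasurableSet B) (hC : MeasurableSet C) :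
    sumTriple A B C ≤ sumTriple (symmetricBall A) (symmetricBall B) (symmetricBall C) := by
  let T : Set (EuclideanSpace ℝ (Fin (m + 1))) → ℕ → Set (EuclideanSpace ℝ (Fin (m + 1))) :=
    fun D k => D ∩ Metric.ball 0 k
  have hTmono : ∀ D, Monotone (T D) := fun D i j hij =>
    inter_subset_inter_right _ (Metric.ball_subset_ball (Nat.cast_le.2 hij))
  have hunion : {p : EuclideanSpace ℝ (Fin (m + 1)) × EuclideanSpace ℝ (Fin (m + 1)) |
      p.1 ∈ A ∧ p.2 ∈ B ∧ p.1 + p.2 ∈ C} =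
      ⋃ k : ℕ, {p | p.1 ∈ T A k ∧ p.2 ∈ T B k ∧ p.1 + p.2 ∈ T C k} := by
    ext p
    simp only [mem_ofPred_eq, mem_iUnion]
    constructor
    · rintro ⟨h1, h2, h3⟩
      obtain ⟨k, hk⟩ := exists_nat_gt (max ‖p.1‖ (max ‖p.2‖ ‖p.1 + p.2‖))
      simp only [max_lt_iff] at hk
      exact ⟨k, ⟨h1, mem_ball_zero_iff.2 hk.1⟩, ⟨h2, mem_ball_zero_iff.2 hk.2.1⟩,
        h3, mem_ball_zero_iff.2 hk.2.2⟩
    · rintro ⟨k, h1, h2, h3⟩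
      exact ⟨h1.1, h2.1, h3.1⟩
  have hmono : Monotone fun k : ℕ =>
      {p : EuclideanSpace ℝ (Fin (m + 1)) × EuclideanSpace ℝ (Fin (m + 1)) |
        p.1 ∈ T A k ∧ p.2 ∈ T B k ∧ p.1 + p.2 ∈ T C k} := fun i j hij p hp =>
    ⟨hTmono A hij hp.1, hTmono B hij hp.2.1, hTmono C hij hp.2.2⟩
  rw [sumTriple, hunion, hmono.measure_iUnion]
  refine iSup_le fun k => ?_
  refine (sumTriple_le_symmetricBall_of_subset_ball (hA.inter measurableSet_ball)
    (hB.inter measurableSet_ball) (hC.inter measurableSet_ball) inter_subset_right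
    inter_subset_right inter_subset_right).trans ?_
  exact sumTriple_mono (symmetricBall_mono inter_subset_left)
    (symmetricBall_mono inter_subset_left) (symmetricBall_mono inter_subset_left)

end Balls

section LayerCake

variable {n : ℕ}

theorem MemS0.tendsto_volume {f : EuclideanSpace ℝ (Fin n) → ℝ} (hf : MemS0 f) :
    Filter.Tendsto (fun k : ℕ => volume {x | (k + 1 : ℝ) < |f x|}) Filter.atTop (nhds 0) := by
  have hm : ∀ k : ℕ, MeasurableSet {x | (k + 1 : ℝ) < |f x|} := fun k =>
    measurableSet_lt measurable_const hf.1.abs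
  have hanti : Antitone fun k : ℕ => {x | (k + 1 : ℝ) < |f x|} := fun i j hij x hx => by
    have : (i : ℝ) ≤ j := Nat.cast_le.2 hij
    simp only [mem_ofPred_eq] at hx ⊢
    linarith
  have h := tendsto_measure_iInter_atTop (μ := volume) (fun k => (hm k).nullMeasurableSet) hanti
    ⟨0, (hf.2 _ (by positivity)).ne⟩
  have hempty : ⋂ k : ℕ, {x | (k + 1 : ℝ) < |f x|} = ∅ := by
    rw [eq_empty_iff_forall_notMem]
    intro x hx
    obtain ⟨k, hk⟩ := exists_nat_gt |f x|
    have : (k + 1 : ℝ) < |f x| := mem_iInter.1 hx k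
    linarith
  rwa [hempty, measure_empty] at h

theorem le_rearr {f : EuclideanSpace ℝ (Fin n) → ℝ} (hf : MemS0 f) {t s : ℝ} (ht : 0 < t)
    (hs : ENNReal.ofReal t < volume {x | s < |f x|}) : s ≤ rearr f t := by
  refine le_csInf ?_ ?_
  · obtain ⟨k, hk⟩ := (hf.tendsto_volume.eventually_lt_const (ofReal_pos.2 ht)).exists
    exact ⟨k + 1, by positivity, hk⟩
  · rintro y ⟨-, hy⟩
    by_contra! hlt
    refine absurd (hs.trans_le ((measure_mono fun x hx => ?_).trans hy.le)) (lt_irrefl _)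
    exact hlt.trans hx

theorem volume_setOf_mem_symmetricBall_le {f : EuclideanSpace ℝ (Fin n) → ℝ} (hf : MemS0 f)
    {x : EuclideanSpace ℝ (Fin n)} (hx : 0 < unitBallVol n * ‖x‖ ^ n) :
    volume {s : ℝ | 0 < s ∧ x ∈ symmetricBall {y | s < |f y|}} ≤
      ENNReal.ofReal (schwarzRearr f x) := by
  refine (measure_mono (t := Ioc 0 (schwarzRearr f x)) fun s hs => ?_).trans ?_
  · exact ⟨hs.1, le_rearr hf hx hs.2⟩
  · rw [Real.volume_Ioc, sub_zero]

theorem schwarzRearr_nonneg (f : EuclideanSpace ℝ (Fin n) → ℝ) (x : EuclideanSpace ℝ (Fin n)) :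
    0 ≤ schwarzRearr f x :=
  Real.sInf_nonneg fun _ hy => hy.1.le

theorem measurableSet_mem_symmetricBall (f : EuclideanSpace ℝ (Fin n) → ℝ) :
    MeasurableSet {p : EuclideanSpace ℝ (Fin n) × ℝ |
      0 < p.2 ∧ p.1 ∈ symmetricBall {y | p.2 < |f y|}} := by
  have hanti : Antitone fun s : ℝ => volume {y | s < |f y|} := fun s t hst =>
    measure_mono fun y hy => lt_of_le_of_lt hst hy
  refine (measurableSet_lt measurable_const measurable_snd).inter (measurableSet_lt ?_ ?_)
  · fun_prop
  · exact hanti.measurable.comp measurable_snd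

theorem setOf_prod_and {s t u : ℝ → Prop} :
    {q : ℝ × ℝ × ℝ | s q.1 ∧ t q.2.1 ∧ u q.2.2} = {a | s a} ×ˢ {a | t a} ×ˢ {a | u a} := rfl

theorem volume_setOf_prod_and {s t u : ℝ → Prop} :
    volume {q : ℝ × ℝ × ℝ | s q.1 ∧ t q.2.1 ∧ u q.2.2} =
      volume {a | s a} * (volume {a | t a} * volume {a | u a}) := by
  rw [setOf_prod_and, Measure.volume_eq_prod, Measure.prod_prod, Measure.volume_eq_prod,
    Measure.prod_prod]

theorem ae_unitBallVol_mul_norm_pow_pos (m : ℕ) :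
    ∀ᵐ x : EuclideanSpace ℝ (Fin (m + 1)), 0 < unitBallVol (m + 1) * ‖x‖ ^ (m + 1) := by
  filter_upwards [Measure.ae_ne volume (0 : EuclideanSpace ℝ (Fin (m + 1)))] with x hx
  exact mul_pos (unitBallVol_pos _) (pow_pos (norm_pos_iff.2 hx) _)

theorem schwarzRearr_fin_zero {f : EuclideanSpace ℝ (Fin 0) → ℝ} (hf0 : ∀ x, 0 ≤ f x)
    (x : EuclideanSpace ℝ (Fin 0)) : schwarzRearr f x = f x := by
  have hv : unitBallVol 0 * ‖x‖ ^ 0 = 1 := by simp [unitBallVol]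
  have hvol : (volume : Measure (EuclideanSpace ℝ (Fin 0))) univ = 1 := by
    rw [← (PiLp.volume_preserving_toLp (Fin 0)).measure_preimage
      MeasurableSet.univ.nullMeasurableSet]
    simp [volume_pi]
  have hset : {y : ℝ | 0 < y ∧ volume {z | y < |f z|} < ENNReal.ofReal 1} =
      {y | 0 < y ∧ f x ≤ y} := by
    ext y
    refine and_congr_right fun hy => ?_
    by_cases h : y < f x
    · have : {z | y < |f z|} = univ := by
        ext z
        simp [Subsingleton.elim z x, abs_of_nonneg (hf0 x), h]
      simp [this, hvol, h]
    · have : {z | y < |f z|} = ∅ := by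
        ext z
        simpa [Subsingleton.elim z x, abs_of_nonneg (hf0 x)] using h
      simpa [this] using h
  rw [schwarzRearr, hv, rearr, hset]
  refine le_antisymm ?_ (le_csInf ⟨f x + 1, by have := hf0 x; constructor <;> linarith⟩
    fun y hy => hy.2)
  refine le_of_forall_pos_le_add fun ε hε => csInf_le ⟨0, fun y hy => hy.1.le⟩ ⟨?_, ?_⟩
  · have := hf0 x; linarith
  · linarith

theorem lintegral_lintegral_sub_eq {G : Type*} [AddCommGroup G] [MeasureSpace G]
    [MeasurableAdd G] [(volume : Measure G).IsAddRightInvariant] (f g h : G → ℝ) :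
    (∫⁻ y, ∫⁻ x, ENNReal.ofReal (f y * g (x - y) * h x)) =
      ∫⁻ y, ∫⁻ z, ENNReal.ofReal (f y * g z * h (y + z)) := by
  refine lintegral_congr fun y => ?_
  rw [← lintegral_sub_right_eq_self (fun z => ENNReal.ofReal (f y * g z * h (y + z))) y]
  simp only [add_sub_cancel]

/-- The Riesz–Sobolev inequality in positive dimension, with `z = x - y` as a variable. -/
theorem lintegral_le_lintegral_schwarzRearr {m : ℕ} (f g h : EuclideanSpace ℝ (Fin (m + 1)) → ℝ)
    (hf : MemS0 f) (hg : MemS0 g) (hh : MemS0 h)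
    (hf0 : ∀ x, 0 ≤ f x) (hg0 : ∀ x, 0 ≤ g x) :
    (∫⁻ y, ∫⁻ z, ENNReal.ofReal (f y * g z * h (y + z))) ≤
      ∫⁻ y, ∫⁻ z, ENNReal.ofReal
        (schwarzRearr f y * schwarzRearr g z * schwarzRearr h (y + z)) := by
  have hfm := hf.1
  have hgm := hg.1
  have hhm := hh.1
  let E := EuclideanSpace ℝ (Fin (m + 1))
  let X : Set ((E × E) × (ℝ × ℝ × ℝ)) := {a |
    (0 < a.2.1 ∧ a.2.1 < f a.1.1) ∧ (0 < a.2.2.1 ∧ a.2.2.1 < g a.1.2) ∧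
      (0 < a.2.2.2 ∧ a.2.2.2 < h (a.1.1 + a.1.2))}
  let X' : Set ((E × E) × (ℝ × ℝ × ℝ)) := {a |
    (0 < a.2.1 ∧ a.1.1 ∈ symmetricBall {y | a.2.1 < |f y|}) ∧
      (0 < a.2.2.1 ∧ a.1.2 ∈ symmetricBall {y | a.2.2.1 < |g y|}) ∧
      (0 < a.2.2.2 ∧ a.1.1 + a.1.2 ∈ symmetricBall {y | a.2.2.2 < |h y|})}
  have hadd : Measurable fun a : (E × E) × (ℝ × ℝ × ℝ) => a.1.1 + a.1.2 :=
    (measurable_fst.comp measurable_fst).add (measurable_snd.comp measurable_fst)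
  have hX : MeasurableSet X := by
    have hsub : ∀ {φ : EuclideanSpace ℝ (Fin (m + 1)) → ℝ}, Measurable φ →
        MeasurableSet {p : EuclideanSpace ℝ (Fin (m + 1)) × ℝ | 0 < p.2 ∧ p.2 < φ p.1} :=
      fun hφ => (measurableSet_lt measurable_const measurable_snd).inter
        (measurableSet_lt measurable_snd (hφ.comp measurable_fst))
    refine MeasurableSet.inter ?_ (MeasurableSet.inter ?_ ?_)
    · exact (hsub hfm).preimage
        (f := fun a : (E × E) × (ℝ × ℝ × ℝ) => (a.1.1, a.2.1)) (by fun_prop)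
    · exact (hsub hgm).preimage
        (f := fun a : (E × E) × (ℝ × ℝ × ℝ) => (a.1.2, a.2.2.1)) (by fun_prop)
    · exact (hsub hhm).preimage
        (f := fun a : (E × E) × (ℝ × ℝ × ℝ) => (a.1.1 + a.1.2, a.2.2.2))
        (hadd.prodMk (by fun_prop))
  have hX' : MeasurableSet X' := by
    refine MeasurableSet.inter ?_ (MeasurableSet.inter ?_ ?_)
    · exact (measurableSet_mem_symmetricBall f).preimage
        (f := fun a : (E × E) × (ℝ × ℝ × ℝ) => (a.1.1, a.2.1)) (by fun_prop)
    · exact (measurableSet_mem_symmetricBall g).preimage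
        (f := fun a : (E × E) × (ℝ × ℝ × ℝ) => (a.1.2, a.2.2.1)) (by fun_prop)
    · exact (measurableSet_mem_symmetricBall h).preimage
        (f := fun a : (E × E) × (ℝ × ℝ × ℝ) => (a.1.1 + a.1.2, a.2.2.2))
        (hadd.prodMk (by fun_prop))
  have hlower : (∫⁻ y, ∫⁻ z, ENNReal.ofReal (f y * g z * h (y + z))) = volume X := by
    rw [Measure.volume_eq_prod, Measure.prod_apply hX, Measure.volume_eq_prod,
      lintegral_prod _ (measurable_measure_prodMk_left hX).aemeasurable]
    refine lintegral_congr fun y => lintegral_congr fun z => ?_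
    have := volume_setOf_prod_and (s := fun s => 0 < s ∧ s < f y)
      (t := fun t => 0 < t ∧ t < g z) (u := fun u => 0 < u ∧ u < h (y + z))
    refine Eq.trans ?_ this.symm
    have hIoo : ∀ c : ℝ, volume {s : ℝ | 0 < s ∧ s < c} = ENNReal.ofReal c := fun c => by
      rw [← sub_zero c, ← Real.volume_Ioo, sub_zero]; rfl
    rw [hIoo, hIoo, hIoo, ENNReal.ofReal_mul (mul_nonneg (hf0 y) (hg0 z)),
      ENNReal.ofReal_mul (hf0 y), mul_assoc]
  have hupper : volume X' ≤ ∫⁻ y, ∫⁻ z, ENNReal.ofReal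
        (schwarzRearr f y * schwarzRearr g z * schwarzRearr h (y + z)) := by
    rw [Measure.volume_eq_prod, Measure.prod_apply hX', Measure.volume_eq_prod,
      lintegral_prod _ (measurable_measure_prodMk_left hX').aemeasurable]
    have hpos := ae_unitBallVol_mul_norm_pow_pos m
    refine lintegral_mono_ae (hpos.mono fun y hy => lintegral_mono_ae ?_)
    filter_upwards [hpos, (measurePreserving_add_left volume y).quasiMeasurePreserving.ae hpos]
      with z hz hyz
    have := volume_setOf_prod_and (s := fun s => 0 < s ∧ y ∈ symmetricBall {x | s < |f x|})
      (t := fun t => 0 < t ∧ z ∈ symmetricBall {x | t < |g x|})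
      (u := fun u => 0 < u ∧ y + z ∈ symmetricBall {x | u < |h x|})
    refine this.trans_le ?_
    rw [ENNReal.ofReal_mul (mul_nonneg (schwarzRearr_nonneg f y) (schwarzRearr_nonneg g z)),
      ENNReal.ofReal_mul (schwarzRearr_nonneg f y), mul_assoc]
    exact mul_le_mul' (volume_setOf_mem_symmetricBall_le hf hy)
      (mul_le_mul' (volume_setOf_mem_symmetricBall_le hg hz)
        (volume_setOf_mem_symmetricBall_le hh hyz))
  refine hlower.trans_le (le_trans ?_ hupper)
  rw [Measure.volume_eq_prod, Measure.prod_apply_symm hX, Measure.prod_apply_symm hX']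
  refine lintegral_mono fun q => ?_
  by_cases hq : 0 < q.1 ∧ 0 < q.2.1 ∧ 0 < q.2.2
  · obtain ⟨h1, h2, h3⟩ := hq
    have key := sumTriple_le_symmetricBall
      (measurableSet_lt (measurable_const (a := q.1)) hfm.abs)
      (measurableSet_lt (measurable_const (a := q.2.1)) hgm.abs)
      (measurableSet_lt (measurable_const (a := q.2.2)) hhm.abs)
    refine (measure_mono ?_).trans (key.trans (measure_mono ?_))
    · rintro p ⟨ha, hb, hc⟩
      exact ⟨ha.2.trans_le (le_abs_self _), hb.2.trans_le (le_abs_self _),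
        hc.2.trans_le (le_abs_self _)⟩
    · rintro p ⟨ha, hb, hc⟩
      exact ⟨⟨h1, ha⟩, ⟨h2, hb⟩, h3, hc⟩
  · refine le_of_eq_of_le (measure_mono_null ?_ measure_empty) zero_le
    rintro p ⟨ha, hb, hc⟩
    exact hq ⟨ha.1, hb.1, hc.1⟩

end LayerCake

/-- **Riesz–Sobolev rearrangement inequality.** For nonnegative `f, g, h ∈ S₀(ℝⁿ)`,
`∫∫ f(y) g(x-y) h(x) dx dy ≤ ∫∫ f*_s(y) g*_s(x-y) h*_s(x) dx dy`. -/
theorem riesz_sobolev_rearrangement {n : ℕ} (f g h : EuclideanSpace ℝ (Fin n) → ℝ)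
    (hf : MemS0 f) (hg : MemS0 g) (hh : MemS0 h)
    (hf0 : ∀ x, 0 ≤ f x) (hg0 : ∀ x, 0 ≤ g x) (hh0 : ∀ x, 0 ≤ h x) :
    (∫⁻ y, ∫⁻ x, ENNReal.ofReal (f y * g (x - y) * h x))
      ≤ ∫⁻ y, ∫⁻ x, ENNReal.ofReal
          (schwarzRearr f y * schwarzRearr g (x - y) * schwarzRearr h x) := by
  cases n with
  | zero => simp only [schwarzRearr_fin_zero hf0, schwarzRearr_fin_zero hg0,
      schwarzRearr_fin_zero hh0, le_refl]
  | succ m =>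
    rw [lintegral_lintegral_sub_eq, lintegral_lintegral_sub_eq]
    exact lintegral_le_lintegral_schwarzRearr f g h hf hg hh hf0 hg0
end

section
/- Let 1/p + 1/q = 1 + 1/r with 1 < p, q, r < ∞, and let 1/μ + 1/ν = 1/s with 0 < μ, ν, s ≤ ∞. Then there is a constant c (depending only on these exponents and n) such that ‖f∗g‖_{r,s} ≤ c ‖f‖_{p,μ} ‖g‖_{q,ν} for all f ∈ L^{p,μ}(ℝⁿ) and g ∈ L^{q,ν}(ℝⁿ). -/
open MeasureTheory Set ENNReal

/-- The Lorentz functional `‖f‖_{p,s}`: for `s < ∞` it is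
`(∫₀^∞ (t^(1/p) f*(t))^s dt/t)^(1/s)`, and for `s = ∞` it is `sup_{t>0} t^(1/p) f*(t)`. -/
noncomputable def lorentzNorm {n : ℕ} (p : ℝ) (s : ℝ≥0∞)
    (f : EuclideanSpace ℝ (Fin n) → ℝ) : ℝ≥0∞ :=
  if s = ∞ then ⨆ t ∈ Ioi (0:ℝ), ENNReal.ofReal (t ^ (1 / p) * rearr f t)
  else (∫⁻ t in Ioi (0:ℝ),
          ENNReal.ofReal (t ^ (1 / p) * rearr f t) ^ s.toReal * ENNReal.ofReal t⁻¹)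
        ^ (1 / s.toReal)

/-- The `ℓ^s` functional of a sequence indexed by `ℤ`. -/
noncomputable def seqNorm (s : ℝ≥0∞) (a : ℤ → ℝ≥0∞) : ℝ≥0∞ :=
  if s = ∞ then ⨆ k, a k else (∑' k, a k ^ s.toReal) ^ (1 / s.toReal)

lemma seqNorm_mono (s : ℝ≥0∞) {a b : ℤ → ℝ≥0∞} (h : ∀ k, a k ≤ b k) :
    seqNorm s a ≤ seqNorm s b := by
  unfold seqNorm
  split_ifs
  · exact iSup_mono h
  · refine ENNReal.rpow_le_rpow (ENNReal.tsum_le_tsum fun k => ?_) (by positivity)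
    exact ENNReal.rpow_le_rpow (h k) toReal_nonneg

lemma seqNorm_const_mul {s : ℝ≥0∞} (hs : 0 < s) (C : ℝ≥0∞) (a : ℤ → ℝ≥0∞) :
    seqNorm s (fun k => C * a k) = C * seqNorm s a := by
  unfold seqNorm
  split_ifs with h
  · rw [ENNReal.mul_iSup]
  · have h0 : 0 < s.toReal := toReal_pos hs.ne' h
    simp_rw [ENNReal.mul_rpow_of_nonneg _ _ h0.le]
    rw [ENNReal.tsum_mul_left, ENNReal.mul_rpow_of_nonneg _ _ (by positivity), ← ENNReal.rpow_mul,
      mul_one_div_cancel h0.ne', ENNReal.rpow_one]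

lemma seqNorm_shift (s : ℝ≥0∞) (a : ℤ → ℝ≥0∞) (u : ℤ) :
    seqNorm s (fun k => a (k + u)) = seqNorm s a := by
  unfold seqNorm
  split_ifs
  · exact (Equiv.addRight u).iSup_comp (g := a)
  · congr 1
    exact (Equiv.addRight u).tsum_eq (fun k => a k ^ s.toReal)

lemma seqNorm_mul_le_top {s : ℝ≥0∞} (hs : 0 < s) (a b : ℤ → ℝ≥0∞) :
    seqNorm s (fun k => a k * b k) ≤ seqNorm ∞ a * seqNorm s b := by
  rw [← seqNorm_const_mul hs]
  refine seqNorm_mono s fun k => ?_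
  gcongr
  simpa [seqNorm] using le_iSup a k

/-- Hölder's inequality for sequences, including exponents below one. -/
lemma seqNorm_mul_le {μ ν s : ℝ≥0∞} (hμ : 0 < μ) (hν : 0 < ν) (hs : 0 < s)
    (h : μ⁻¹ + ν⁻¹ = s⁻¹) (a b : ℤ → ℝ≥0∞) :
    seqNorm s (fun k => a k * b k) ≤ seqNorm μ a * seqNorm ν b := by
  by_cases hμt : μ = ∞
  · subst hμt
    have : ν = s := by simpa using h
    subst this
    exact seqNorm_mul_le_top hs a b
  by_cases hνt : ν = ∞
  · subst hνt
    have : μ = s := by simpa using h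
    subst this
    simp_rw [mul_comm (a _), mul_comm (seqNorm _ a)]
    exact seqNorm_mul_le_top hs b a
  have hst : s ≠ ∞ := by
    rintro rfl
    simp [hμt, hνt] at h
  have h0 := toReal_pos hs.ne' hst
  have h1 := toReal_pos hμ.ne' hμt
  have h2 := toReal_pos hν.ne' hνt
  have h3 : μ.toReal⁻¹ + ν.toReal⁻¹ = s.toReal⁻¹ := by
    rw [← toReal_inv, ← toReal_inv, ← toReal_inv, ← toReal_add (by simpa using hμ.ne')
      (by simpa using hν.ne'), h]
  have h4 : s.toReal < μ.toReal := by
    rw [← inv_lt_inv₀ h1 h0, ← h3]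
    linarith [inv_pos.2 h2]
  have := ENNReal.lintegral_Lp_mul_le_Lq_mul_Lr h0 h4
    (by simpa using h3.symm : 1 / s.toReal = 1 / μ.toReal + 1 / ν.toReal) Measure.count
    (measurable_of_countable a).aemeasurable (measurable_of_countable b).aemeasurable
  simpa [seqNorm, hst, hμt, hνt, lintegral_count] using this

/-- Two-sided exponential decay. -/
noncomputable def decay (ε : ℝ) (u : ℤ) : ℝ≥0∞ := 2 ^ (-(ε * |(u : ℝ)|))

lemma tsum_decay_lt_top {ε : ℝ} (hε : 0 < ε) : ∑' u, decay ε u < ∞ := by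
  have hs : Summable fun u : ℤ => (2 : ℝ) ^ (-(ε * |(u : ℝ)|)) := by
    have : Summable fun k : ℕ => (2 : ℝ) ^ (-(ε * |(k : ℝ)|)) := by
      have h1 : (2 : ℝ) ^ (-ε) < 1 := Real.rpow_lt_one_of_one_lt_of_neg (by norm_num) (by linarith)
      convert summable_geometric_of_lt_one (by positivity) h1 using 2 with k
      rw [← Real.rpow_natCast, ← Real.rpow_mul (by norm_num), Nat.abs_cast, neg_mul]
    refine Summable.of_nat_of_neg ?_ ?_
    · simpa using this
    · simpa using this
  have h : ∀ u, decay ε u = ENNReal.ofReal ((2 : ℝ) ^ (-(ε * |(u : ℝ)|))) := fun u => by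
    rw [← ENNReal.ofReal_rpow_of_pos (by norm_num)]
    simp [decay]
  simp_rw [h]
  rw [← ENNReal.ofReal_tsum_of_nonneg (fun _ => by positivity) hs]
  exact ofReal_lt_top

lemma decay_rpow (ε σ : ℝ) (u : ℤ) : decay ε u ^ σ = decay (ε * σ) u := by
  rw [decay, decay, ← ENNReal.rpow_mul]
  ring_nf

/-- Convolution with an exponentially decaying kernel is bounded on `ℓ^μ` for every `μ > 0`. -/
lemma exists_seqNorm_conv_decay_le {ε : ℝ} (hε : 0 < ε) {μ : ℝ≥0∞} (hμ : 0 < μ) :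
    ∃ C : ℝ≥0∞, C < ∞ ∧ ∀ a : ℤ → ℝ≥0∞,
      seqNorm μ (fun m => ∑' j, a j * decay ε (j - m)) ≤ C * seqNorm μ a := by
  set δ := ε / 2
  have hδ : 0 < δ := by positivity
  set K := ∑' u, decay δ u
  have hK : K < ∞ := tsum_decay_lt_top hδ
  have key : ∀ (a : ℤ → ℝ≥0∞) (m : ℤ), ∑' j, a j * decay ε (j - m) ≤
      K * ⨆ u, a (u + m) * decay δ u := by
    intro a m
    rw [← (Equiv.addRight m).tsum_eq (fun j => a j * decay ε (j - m)), ← ENNReal.tsum_mul_right]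
    refine ENNReal.tsum_le_tsum fun u => ?_
    have : decay ε u = decay δ u * decay δ u := by
      rw [decay, decay, ← ENNReal.rpow_add _ _ (by norm_num) (by norm_num)]
      congr 1
      simp only [δ]
      ring
    simp only [Equiv.coe_addRight, add_sub_cancel_right]
    rw [this, mul_left_comm]
    gcongr
    exact le_iSup (fun u => a (u + m) * decay δ u) u
  have key' : ∀ (a : ℤ → ℝ≥0∞), seqNorm μ (fun m => ∑' j, a j * decay ε (j - m)) ≤
      K * seqNorm μ (fun m => ⨆ u, a (u + m) * decay δ u) := by
    intro a
    rw [← seqNorm_const_mul hμ]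
    exact seqNorm_mono μ (key a)
  by_cases hμt : μ = ∞
  · refine ⟨K, hK, fun a => (key' a).trans ?_⟩
    gcongr
    simp only [seqNorm, hμt, if_true]
    refine iSup_le fun m => iSup_le fun u => ?_
    calc a (u + m) * decay δ u ≤ a (u + m) * 1 := by
          gcongr
          rw [decay, ← ENNReal.rpow_zero (x := 2)]
          exact ENNReal.rpow_le_rpow_of_exponent_le one_le_two
            (neg_nonpos.2 (mul_nonneg hδ.le (abs_nonneg _)))
      _ ≤ ⨆ k, a k := by simpa using le_iSup a (u + m)
  · have h0 := toReal_pos hμ.ne' hμt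
    have hK' : ∑' u, decay (δ * μ.toReal) u < ∞ := tsum_decay_lt_top (by positivity)
    refine ⟨K * (∑' u, decay (δ * μ.toReal) u) ^ (1 / μ.toReal),
      ENNReal.mul_lt_top hK (ENNReal.rpow_lt_top_of_nonneg (by positivity) hK'.ne),
      fun a => (key' a).trans ?_⟩
    rw [mul_assoc]
    gcongr
    simp only [seqNorm, hμt, if_false]
    rw [← ENNReal.mul_rpow_of_nonneg _ _ (by positivity)]
    gcongr
    calc ∑' m, (⨆ u, a (u + m) * decay δ u) ^ μ.toReal
        ≤ ∑' m, ∑' u, a (u + m) ^ μ.toReal * decay (δ * μ.toReal) u := by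
          refine ENNReal.tsum_le_tsum fun m => ?_
          rw [← ENNReal.le_rpow_inv_iff h0]
          refine iSup_le fun u => ?_
          rw [ENNReal.le_rpow_inv_iff h0, ENNReal.mul_rpow_of_nonneg _ _ h0.le, decay_rpow]
          exact ENNReal.le_tsum (f := fun u => a (u + m) ^ μ.toReal * decay (δ * μ.toReal) u) u
      _ = ∑' u, ∑' m, a (u + m) ^ μ.toReal * decay (δ * μ.toReal) u := ENNReal.tsum_comm
      _ = ∑' u, (∑' k, a k ^ μ.toReal) * decay (δ * μ.toReal) u := by
          refine tsum_congr fun u => ?_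
          rw [ENNReal.tsum_mul_right]
          congr 1
          exact (Equiv.addLeft u).tsum_eq (fun k => a k ^ μ.toReal)
      _ = _ := by rw [ENNReal.tsum_mul_left, mul_comm]

lemma ofReal_two_rpow (x : ℝ) : ENNReal.ofReal ((2 : ℝ) ^ x) = 2 ^ x := by
  rw [← ENNReal.ofReal_rpow_of_pos (by norm_num)]
  simp

lemma ofReal_two_zpow (k : ℤ) : ENNReal.ofReal ((2 : ℝ) ^ k) = 2 ^ (k : ℝ) := by
  rw [← Real.rpow_intCast, ofReal_two_rpow]

lemma iUnion_Ioc_two_zpow : ⋃ k : ℤ, Ioc ((2 : ℝ) ^ k) (2 ^ (k + 1)) = Ioi 0 := by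
  ext t
  simp only [mem_iUnion]
  constructor
  · rintro ⟨k, hk⟩
    exact (by positivity : (0 : ℝ) < 2 ^ k).trans hk.1
  · exact fun ht => exists_mem_Ioc_zpow ht one_lt_two

lemma lintegral_Ioi_eq_tsum (φ : ℝ → ℝ≥0∞) :
    ∫⁻ t in Ioi (0 : ℝ), φ t = ∑' k : ℤ, ∫⁻ t in Ioc ((2 : ℝ) ^ k) (2 ^ (k + 1)), φ t := by
  rw [← iUnion_Ioc_two_zpow, lintegral_iUnion (fun _ => measurableSet_Ioc)]
  have hmono : Monotone fun k : ℤ => (2 : ℝ) ^ k := zpow_right_mono₀ one_le_two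
  exact hmono.pairwise_disjoint_on_Ioc_succ

lemma volume_Ioc_two_zpow (k : ℤ) :
    volume (Ioc ((2 : ℝ) ^ k) (2 ^ (k + 1))) = ENNReal.ofReal (2 ^ k) := by
  rw [Real.volume_Ioc, zpow_add_one₀ two_ne_zero]
  congr 1
  ring

lemma setLIntegral_Ioc_inv_le (k : ℤ) :
    ∫⁻ t in Ioc ((2 : ℝ) ^ k) (2 ^ (k + 1)), ENNReal.ofReal t⁻¹ ≤ 1 := by
  calc _ ≤ ∫⁻ t in Ioc ((2 : ℝ) ^ k) (2 ^ (k + 1)), ENNReal.ofReal (2 ^ k)⁻¹ := by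
        refine setLIntegral_mono' measurableSet_Ioc fun t ht => ?_
        gcongr
        exact ht.1.le
    _ = 1 := by
        rw [setLIntegral_const, volume_Ioc_two_zpow, ← ENNReal.ofReal_mul (by positivity),
          inv_mul_cancel₀ (by positivity), ofReal_one]

lemma one_le_two_mul_setLIntegral_Ioc_inv (k : ℤ) :
    1 ≤ 2 * ∫⁻ t in Ioc ((2 : ℝ) ^ k) (2 ^ (k + 1)), ENNReal.ofReal t⁻¹ := by
  calc 1 = 2 * ∫⁻ t in Ioc ((2 : ℝ) ^ k) (2 ^ (k + 1)), ENNReal.ofReal (2 ^ (k + 1))⁻¹ := by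
        rw [setLIntegral_const, volume_Ioc_two_zpow, ← ENNReal.ofReal_mul (by positivity),
          zpow_add_one₀ two_ne_zero, ← ofReal_ofNat 2, ← ENNReal.ofReal_mul (by positivity),
          ← ofReal_one]
        congr 1
        field_simp
    _ ≤ _ := by
        gcongr 2 * ?_
        refine setLIntegral_mono' measurableSet_Ioc fun t ht => ?_
        have : 0 < t := (by positivity : (0 : ℝ) < 2 ^ k).trans ht.1
        gcongr
        exact ht.2

section

variable {n : ℕ}

lemma lorentzNorm_le_seqNorm (r : ℝ) (s : ℝ≥0∞) (h : EuclideanSpace ℝ (Fin n) → ℝ)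
    (d : ℤ → ℝ≥0∞) (hd : ∀ k : ℤ, ∀ t ∈ Ioc ((2 : ℝ) ^ k) (2 ^ (k + 1)),
      ENNReal.ofReal (t ^ (1 / r) * rearr h t) ≤ d k) :
    lorentzNorm r s h ≤ seqNorm s d := by
  unfold lorentzNorm seqNorm
  split_ifs with hs
  · refine iSup₂_le fun t ht => ?_
    obtain ⟨k, hk⟩ := exists_mem_Ioc_zpow (mem_Ioi.1 ht) one_lt_two
    exact (hd k t hk).trans (le_iSup d k)
  · refine ENNReal.rpow_le_rpow ?_ (by positivity)
    rw [lintegral_Ioi_eq_tsum]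
    refine ENNReal.tsum_le_tsum fun k => ?_
    calc _ ≤ ∫⁻ t in Ioc ((2 : ℝ) ^ k) (2 ^ (k + 1)), d k ^ s.toReal * ENNReal.ofReal t⁻¹ := by
          refine setLIntegral_mono' measurableSet_Ioc fun t ht => ?_
          gcongr
          exact hd k t ht
      _ = d k ^ s.toReal * ∫⁻ t in Ioc ((2 : ℝ) ^ k) (2 ^ (k + 1)), ENNReal.ofReal t⁻¹ :=
          lintegral_const_mul _ (by fun_prop)
      _ ≤ d k ^ s.toReal := mul_le_of_le_one_right' (setLIntegral_Ioc_inv_le k)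

lemma seqNorm_le_lorentzNorm (p : ℝ) (s : ℝ≥0∞)
    (f : EuclideanSpace ℝ (Fin n) → ℝ) (d : ℤ → ℝ≥0∞)
    (hd : ∀ k : ℤ, ∀ t ∈ Ioc ((2 : ℝ) ^ k) (2 ^ (k + 1)),
      d k ≤ ENNReal.ofReal (t ^ (1 / p) * rearr f t)) :
    seqNorm s d ≤ 2 ^ (1 / s.toReal) * lorentzNorm p s f := by
  unfold lorentzNorm seqNorm
  split_ifs with hs
  · rw [hs, ENNReal.toReal_top, _root_.div_zero, ENNReal.rpow_zero, one_mul]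
    refine iSup_le fun k => ?_
    have hk : (2 : ℝ) ^ (k + 1) ∈ Ioc ((2 : ℝ) ^ k) (2 ^ (k + 1)) :=
      ⟨zpow_lt_zpow_right₀ one_lt_two (by lia), le_rfl⟩
    exact (hd k _ hk).trans (le_iSup₂ (f := fun t (_ : t ∈ Ioi (0 : ℝ)) =>
      ENNReal.ofReal (t ^ (1 / p) * rearr f t)) ((2 : ℝ) ^ (k + 1)) (mem_Ioi.2 (by positivity)))
  · rw [← ENNReal.mul_rpow_of_nonneg _ _ (by positivity)]
    refine ENNReal.rpow_le_rpow ?_ (by positivity)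
    rw [lintegral_Ioi_eq_tsum, ← ENNReal.tsum_mul_left]
    refine ENNReal.tsum_le_tsum fun k => ?_
    calc d k ^ s.toReal
        ≤ d k ^ s.toReal * (2 * ∫⁻ t in Ioc ((2 : ℝ) ^ k) (2 ^ (k + 1)), ENNReal.ofReal t⁻¹) :=
          le_mul_of_one_le_right' (one_le_two_mul_setLIntegral_Ioc_inv k)
      _ = 2 * ∫⁻ t in Ioc ((2 : ℝ) ^ k) (2 ^ (k + 1)), d k ^ s.toReal * ENNReal.ofReal t⁻¹ := by
          rw [lintegral_const_mul _ (by fun_prop), mul_left_comm]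
      _ ≤ _ := by
          gcongr 2 * ?_
          refine setLIntegral_mono' measurableSet_Ioc fun t ht => ?_
          gcongr
          exact hd k t ht

lemma rearr_nonneg (f : EuclideanSpace ℝ (Fin n) → ℝ) (t : ℝ) : 0 ≤ rearr f t :=
  Real.sInf_nonneg fun _ hy => hy.1.le

lemma rearr_le_of_volume_lt {f : EuclideanSpace ℝ (Fin n) → ℝ} {t y : ℝ} (hy : 0 < y)
    (h : volume {x | y < |f x|} < ENNReal.ofReal t) : rearr f t ≤ y :=
  csInf_le ⟨0, fun _ hz => hz.1.le⟩ ⟨hy, h⟩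

lemma antitone_volume_superlevel (f : EuclideanSpace ℝ (Fin n) → ℝ) :
    Antitone fun y : ℝ => volume {x | y < |f x|} :=
  fun _ _ hab => measure_mono fun _ hx => lt_of_le_of_lt hab hx

lemma MemS0.exists_volume_lt {f : EuclideanSpace ℝ (Fin n) → ℝ} (hf : MemS0 f) {t : ℝ}
    (ht : 0 < t) : ∃ y : ℝ, 0 < y ∧ volume {x | y < |f x|} < ENNReal.ofReal t := by
  have hanti : Antitone fun k : ℕ => {x | ((k : ℝ) + 1) < |f x|} := fun a b hab x hx => by
    have : (a : ℝ) ≤ b := by exact_mod_cast hab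
    simp only [mem_ofPred_eq] at hx ⊢
    linarith
  have hmeas : ∀ k : ℕ, MeasurableSet {x | ((k : ℝ) + 1) < |f x|} := fun k =>
    measurableSet_lt measurable_const (continuous_abs.measurable.comp hf.1)
  have h := hanti.measure_iInter (μ := volume) (fun k => (hmeas k).nullMeasurableSet)
    ⟨0, (hf.2 _ (by positivity)).ne⟩
  have hempty : ⋂ k : ℕ, {x | ((k : ℝ) + 1) < |f x|} = ∅ := by
    ext x
    simp only [mem_iInter, mem_ofPred_eq, mem_empty_iff_false, iff_false, not_forall, not_lt]
    obtain ⟨k, hk⟩ := exists_nat_gt |f x|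
    exact ⟨k, by linarith⟩
  rw [hempty, measure_empty] at h
  obtain ⟨k, hk⟩ := iInf_lt_iff.1 (h ▸ ofReal_pos.2 ht)
  exact ⟨k + 1, by positivity, hk⟩

lemma MemS0.rearr_antitoneOn {f : EuclideanSpace ℝ (Fin n) → ℝ} (hf : MemS0 f) :
    AntitoneOn (rearr f) (Ioi 0) := fun _ ht _ _ htt' =>
  csInf_le_csInf ⟨0, fun _ hz => hz.1.le⟩ (hf.exists_volume_lt ht)
    fun _ hy => ⟨hy.1, hy.2.trans_le (ofReal_le_ofReal htt')⟩

lemma MemS0.volume_rearr_lt_le {f : EuclideanSpace ℝ (Fin n) → ℝ} (hf : MemS0 f) {t : ℝ}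
    (ht : 0 < t) : volume {x | rearr f t < |f x|} ≤ ENNReal.ofReal t := by
  have hunion : {x | rearr f t < |f x|} = ⋃ k : ℕ, {x | rearr f t + 1 / ((k : ℝ) + 1) < |f x|} := by
    ext x
    simp only [mem_iUnion, mem_ofPred_eq]
    constructor
    · intro hx
      obtain ⟨k, hk⟩ := exists_nat_one_div_lt (sub_pos.2 hx)
      exact ⟨k, by linarith⟩
    · rintro ⟨k, hk⟩
      have : (0 : ℝ) < 1 / ((k : ℝ) + 1) := by positivity
      linarith
  rw [hunion, Monotone.measure_iUnion]
  · refine iSup_le fun k => ?_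
    have hpos : (0 : ℝ) < 1 / ((k : ℝ) + 1) := by positivity
    obtain ⟨y, hy, hlt⟩ := exists_lt_of_csInf_lt (hf.exists_volume_lt ht)
      (show rearr f t < rearr f t + 1 / ((k : ℝ) + 1) by linarith)
    exact (antitone_volume_superlevel f hlt.le).trans hy.2.le
  · intro a b hab x hx
    have : 1 / ((b : ℝ) + 1) ≤ 1 / ((a : ℝ) + 1) := by gcongr
    simp only [mem_ofPred_eq] at hx ⊢
    linarith

lemma MemS0.exists_rearr_two_zpow_lt {f : EuclideanSpace ℝ (Fin n) → ℝ} (hf : MemS0 f) {y : ℝ}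
    (hy : 0 < y) : ∃ k : ℤ, rearr f (2 ^ k) < y := by
  have hfin := hf.2 (y / 2) (by positivity)
  obtain ⟨k, hk⟩ := pow_unbounded_of_one_lt (volume {x | y / 2 < |f x|}).toReal one_lt_two
  refine ⟨k, (rearr_le_of_volume_lt (half_pos hy) ?_).trans_lt (half_lt_self hy)⟩
  rw [zpow_natCast]
  exact (ENNReal.lt_ofReal_iff_toReal_lt hfin.ne).2 hk

/-- A.e. pointwise domination of a function by its dyadic rearrangement. -/
lemma MemS0.ae_enorm_le_tsum {f : EuclideanSpace ℝ (Fin n) → ℝ} (hf : MemS0 f) :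
    ∀ᵐ x, ‖f x‖ₑ ≤ ∑' k : ℤ, ENNReal.ofReal (rearr f (2 ^ k)) *
      {x | rearr f (2 ^ (k + 1)) < |f x|}.indicator 1 x := by
  have hnull : volume {x | ∀ k : ℤ, rearr f (2 ^ k) < |f x|} = 0 := by
    have hle : ∀ m : ℕ, volume {x | ∀ k : ℤ, rearr f (2 ^ k) < |f x|} ≤
        ENNReal.ofReal ((1 / 2) ^ m) := fun m => by
      have h := hf.volume_rearr_lt_le (t := 2 ^ (-m : ℤ)) (by positivity)
      rw [zpow_neg, zpow_natCast, ← inv_pow, ← one_div] at h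
      refine (measure_mono fun x hx => ?_).trans h
      simpa using hx (-m)
    have hlim : Filter.Tendsto (fun m : ℕ => ENNReal.ofReal ((1 / 2 : ℝ) ^ m)) Filter.atTop
        (nhds 0) := by
      simpa using ENNReal.tendsto_ofReal
        (tendsto_pow_atTop_nhds_zero_of_lt_one (r := (1 / 2 : ℝ)) (by norm_num) (by norm_num))
    exact le_antisymm (ge_of_tendsto' hlim hle) zero_le
  filter_upwards [compl_mem_ae_iff.2 hnull] with x hx
  rcases eq_or_ne (f x) 0 with h0 | h0
  · simp [h0]
  obtain ⟨j, hj⟩ := hf.exists_rearr_two_zpow_lt (abs_pos.2 h0)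
  simp only [mem_compl_iff, mem_ofPred_eq, not_forall, not_lt] at hx
  obtain ⟨i, hi⟩ := hx
  have hmono : ∀ a b : ℤ, a ≤ b → rearr f (2 ^ b) ≤ rearr f (2 ^ a) := fun a b hab =>
    hf.rearr_antitoneOn (mem_Ioi.2 (by positivity)) (mem_Ioi.2 (by positivity))
      (zpow_le_zpow_right₀ one_le_two hab)
  obtain ⟨k, hk1, hk2⟩ : ∃ k : ℤ, |f x| ≤ rearr f (2 ^ k) ∧ rearr f (2 ^ (k + 1)) < |f x| := by
    by_contra! hcon
    have : ∀ m : ℕ, |f x| ≤ rearr f (2 ^ (i + m)) := by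
      intro m
      induction m with
      | zero => simpa using hi
      | succ m ih =>
        have := hcon _ ih
        push_cast
        rwa [← add_assoc]
    have h1 := this (j - i).toNat
    have h2 := hmono j (i + (j - i).toNat) (by lia)
    linarith
  refine le_trans ?_ (ENNReal.le_tsum k)
  rw [indicator_of_mem (by exact hk2)]
  simpa [← ofReal_norm] using ENNReal.ofReal_le_ofReal hk1

end

section

variable {n : ℕ}

/-- The convolution of the indicator functions of two sets, as an extended nonnegative function. -/
noncomputable def indConv (A B : Set (EuclideanSpace ℝ (Fin n))) (x : EuclideanSpace ℝ (Fin n)) :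
    ℝ≥0∞ :=
  ∫⁻ y, A.indicator 1 (x - y) * B.indicator 1 y

lemma indicator_one_le_one {α : Type*} (A : Set α) (x : α) :
    A.indicator (1 : α → ℝ≥0∞) x ≤ 1 :=
  indicator_le_self' (by simp) x

lemma measurable_indConv_integrand {A B : Set (EuclideanSpace ℝ (Fin n))}
    (hA : MeasurableSet A) (hB : MeasurableSet B) :
    Measurable fun z : EuclideanSpace ℝ (Fin n) × EuclideanSpace ℝ (Fin n) =>
      A.indicator (1 : EuclideanSpace ℝ (Fin n) → ℝ≥0∞) (z.1 - z.2) * B.indicator 1 z.2 :=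
  ((measurable_one.indicator hA).comp (measurable_fst.sub measurable_snd)).mul
    ((measurable_one.indicator hB).comp measurable_snd)

lemma measurable_indConv {A B : Set (EuclideanSpace ℝ (Fin n))}
    (hA : MeasurableSet A) (hB : MeasurableSet B) : Measurable (indConv A B) :=
  (measurable_indConv_integrand hA hB).lintegral_prod_right'

lemma indConv_le_left {A : Set (EuclideanSpace ℝ (Fin n))} (hA : MeasurableSet A)
    (B : Set (EuclideanSpace ℝ (Fin n))) (x : EuclideanSpace ℝ (Fin n)) :
    indConv A B x ≤ volume A := by
  calc indConv A B x ≤ ∫⁻ y, A.indicator 1 (x - y) :=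
        lintegral_mono fun y => mul_le_of_le_one_right' (indicator_one_le_one B y)
    _ = volume A := by
        rw [lintegral_sub_left_eq_self
            (fun y => A.indicator (1 : EuclideanSpace ℝ (Fin n) → ℝ≥0∞) y) x,
          lintegral_indicator_one hA]

lemma indConv_le_right (A : Set (EuclideanSpace ℝ (Fin n)))
    {B : Set (EuclideanSpace ℝ (Fin n))} (hB : MeasurableSet B) (x : EuclideanSpace ℝ (Fin n)) :
    indConv A B x ≤ volume B := by
  calc indConv A B x ≤ ∫⁻ y, B.indicator 1 y :=
        lintegral_mono fun y => mul_le_of_le_one_left' (indicator_one_le_one A (x - y))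
    _ = volume B := lintegral_indicator_one hB

lemma lintegral_indConv {A B : Set (EuclideanSpace ℝ (Fin n))}
    (hA : MeasurableSet A) (hB : MeasurableSet B) :
    ∫⁻ x, indConv A B x = volume A * volume B := by
  unfold indConv
  rw [lintegral_lintegral_swap (measurable_indConv_integrand hA hB).aemeasurable]
  have h : ∀ y, ∫⁻ x, A.indicator (1 : EuclideanSpace ℝ (Fin n) → ℝ≥0∞) (x - y) *
      B.indicator 1 y = volume A * B.indicator 1 y := fun y => by
    have hm : Measurable fun x => A.indicator (1 : EuclideanSpace ℝ (Fin n) → ℝ≥0∞) (x - y) :=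
      (measurable_one.indicator hA).comp (measurable_id.sub measurable_const)
    rw [lintegral_mul_const _ hm,
      lintegral_sub_right_eq_self (fun x => A.indicator (1 : EuclideanSpace ℝ (Fin n) → ℝ≥0∞) x) y,
      lintegral_indicator_one hA]
  simp_rw [h]
  rw [lintegral_const_mul _ (measurable_one.indicator hB), lintegral_indicator_one hB]

/-- The value of the rearrangement at `2 ^ k`. -/
noncomputable def dyadicValue (f : EuclideanSpace ℝ (Fin n) → ℝ) (k : ℤ) : ℝ≥0∞ :=
  ENNReal.ofReal (rearr f (2 ^ k))

/-- The superlevel set of `f` at the height `f*(2 ^ (k + 1))`. -/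
def dyadicLevel (f : EuclideanSpace ℝ (Fin n) → ℝ) (k : ℤ) : Set (EuclideanSpace ℝ (Fin n)) :=
  {x | rearr f (2 ^ (k + 1)) < |f x|}

lemma MemS0.measurableSet_dyadicLevel {f : EuclideanSpace ℝ (Fin n) → ℝ} (hf : MemS0 f) (k : ℤ) :
    MeasurableSet (dyadicLevel f k) :=
  measurableSet_lt measurable_const (continuous_abs.measurable.comp hf.1)

lemma MemS0.volume_dyadicLevel_le {f : EuclideanSpace ℝ (Fin n) → ℝ} (hf : MemS0 f) (k : ℤ) :
    volume (dyadicLevel f k) ≤ 2 * 2 ^ (k : ℝ) := by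
  refine (hf.volume_rearr_lt_le (t := 2 ^ (k + 1)) (by positivity)).trans_eq ?_
  rw [zpow_add_one₀ two_ne_zero, ENNReal.ofReal_mul (by positivity), ofReal_two_zpow, mul_comm]
  simp

lemma enorm_conv_le_tsum {f g : EuclideanSpace ℝ (Fin n) → ℝ} (hf : MemS0 f) (hg : MemS0 g)
    (x : EuclideanSpace ℝ (Fin n)) :
    ‖∫ y, f (x - y) * g y‖ₑ ≤ ∑' z : ℤ × ℤ, dyadicValue f z.1 * dyadicValue g z.2 *
      indConv (dyadicLevel f z.1) (dyadicLevel g z.2) x := by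
  have hf' := (quasiMeasurePreserving_sub_left volume x).ae hf.ae_enorm_le_tsum
  calc ‖∫ y, f (x - y) * g y‖ₑ ≤ ∫⁻ y, ‖f (x - y) * g y‖ₑ := enorm_integral_le_lintegral_enorm _
    _ ≤ ∫⁻ y, ∑' z : ℤ × ℤ, dyadicValue f z.1 * dyadicValue g z.2 *
        ((dyadicLevel f z.1).indicator 1 (x - y) * (dyadicLevel g z.2).indicator 1 y) := by
        refine lintegral_mono_ae ?_
        filter_upwards [hf', hg.ae_enorm_le_tsum] with y h1 h2
        rw [enorm_mul]
        refine (mul_le_mul' h1 h2).trans_eq ?_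
        rw [ENNReal.tsum_prod', ← ENNReal.tsum_mul_right]
        refine tsum_congr fun j => ?_
        rw [← ENNReal.tsum_mul_left]
        refine tsum_congr fun k => ?_
        exact mul_mul_mul_comm _ _ _ _
    _ = _ := by
        have hm : ∀ z : ℤ × ℤ, Measurable fun y =>
            (dyadicLevel f z.1).indicator (1 : EuclideanSpace ℝ (Fin n) → ℝ≥0∞) (x - y) *
              (dyadicLevel g z.2).indicator 1 y := fun z =>
          (measurable_indConv_integrand (hf.measurableSet_dyadicLevel z.1)
            (hg.measurableSet_dyadicLevel z.2)).comp measurable_prodMk_left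
        rw [lintegral_tsum fun z => ((hm z).const_mul _).aemeasurable]
        exact tsum_congr fun z => lintegral_const_mul _ (hm z)

/-- The dyadic majorant of the rearrangement of `f ∗ g` at `2 ^ m`. -/
noncomputable def dyadicMajorant (f g : EuclideanSpace ℝ (Fin n) → ℝ) (m : ℤ) : ℝ≥0∞ :=
  ∑' z : ℤ × ℤ, dyadicValue f z.1 * dyadicValue g z.2 *
    2 ^ (min (min (z.1 : ℝ) z.2) (z.1 + z.2 - m))

lemma volume_conv_superlevel_le {f g : EuclideanSpace ℝ (Fin n) → ℝ} (hf : MemS0 f) (hg : MemS0 g)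
    (m : ℤ) : volume {x | 6 * dyadicMajorant f g m < ‖∫ y, f (x - y) * g y‖ₑ} ≤
      2 ^ (m : ℝ) := by
  set T := dyadicMajorant f g m with hT
  rcases eq_or_ne T ∞ with hTt | hTt
  · simp [hTt]
  set c : ℤ × ℤ → ℝ≥0∞ := fun z => dyadicValue f z.1 * dyadicValue g z.2 with hc
  set I : ℤ × ℤ → EuclideanSpace ℝ (Fin n) → ℝ≥0∞ := fun z =>
    indConv (dyadicLevel f z.1) (dyadicLevel g z.2) with hI
  set P : Set (ℤ × ℤ) := {z | z.1 ≤ m ∧ z.2 ≤ m} with hP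
  set S : EuclideanSpace ℝ (Fin n) → ℝ≥0∞ := fun x => ∑' z, P.indicator c z * I z x with hS
  have hIm : ∀ z, Measurable (I z) := fun z =>
    measurable_indConv (hf.measurableSet_dyadicLevel z.1) (hg.measurableSet_dyadicLevel z.2)
  have hbound : ∀ x, ‖∫ y, f (x - y) * g y‖ₑ ≤ S x + 2 * T := by
    intro x
    refine (enorm_conv_le_tsum hf hg x).trans ?_
    rw [hT, dyadicMajorant, ← ENNReal.tsum_mul_left, hS, ← ENNReal.tsum_add]
    refine ENNReal.tsum_le_tsum fun z => ?_
    by_cases hz : z ∈ P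
    · rw [indicator_of_mem hz]
      exact le_self_add
    · rw [indicator_of_notMem hz, zero_mul, zero_add, mul_left_comm]
      gcongr
      have h1 := (indConv_le_left (hf.measurableSet_dyadicLevel z.1) (dyadicLevel g z.2) x).trans
        (hf.volume_dyadicLevel_le z.1)
      have h2 := (indConv_le_right (dyadicLevel f z.1) (hg.measurableSet_dyadicLevel z.2) x).trans
        (hg.volume_dyadicLevel_le z.2)
      have h3 : min (z.1 : ℝ) z.2 ≤ z.1 + z.2 - m := by
        simp only [hP, mem_ofPred_eq, not_and_or, not_le] at hz
        rcases hz with hz | hz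
        · have : (m : ℝ) < z.1 := by exact_mod_cast hz
          exact (min_le_right _ _).trans (by linarith)
        · have : (m : ℝ) < z.2 := by exact_mod_cast hz
          exact (min_le_left _ _).trans (by linarith)
      rw [min_eq_left h3]
      rcases min_choice (z.1 : ℝ) z.2 with h | h <;> rw [h] <;> assumption
  have hint : ∫⁻ x, S x ≤ 2 ^ (m : ℝ) * (4 * T) := by
    rw [hS, lintegral_tsum fun z => ((hIm z).const_mul _).aemeasurable, hT, dyadicMajorant,
      ← ENNReal.tsum_mul_left, ← ENNReal.tsum_mul_left]
    refine ENNReal.tsum_le_tsum fun z => ?_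
    rw [lintegral_const_mul _ (hIm z)]
    by_cases hz : z ∈ P
    · rw [indicator_of_mem hz, hI, lintegral_indConv (hf.measurableSet_dyadicLevel z.1)
        (hg.measurableSet_dyadicLevel z.2)]
      have h1 : (z.1 : ℝ) ≤ m := by exact_mod_cast hz.1
      have h2 : (z.2 : ℝ) ≤ m := by exact_mod_cast hz.2
      rw [min_eq_right (le_min (by linarith) (by linarith))]
      calc c z * (volume (dyadicLevel f z.1) * volume (dyadicLevel g z.2))
          ≤ c z * ((2 * 2 ^ (z.1 : ℝ)) * (2 * 2 ^ (z.2 : ℝ))) := by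
            gcongr
            · exact hf.volume_dyadicLevel_le z.1
            · exact hg.volume_dyadicLevel_le z.2
        _ = 4 * (c z * (2 ^ (z.1 : ℝ) * 2 ^ (z.2 : ℝ))) := by ring
        _ = 4 * (c z * (2 ^ (m : ℝ) * 2 ^ ((z.1 : ℝ) + z.2 - m))) := by
            rw [← ENNReal.rpow_add _ _ (by norm_num) (by norm_num),
              ← ENNReal.rpow_add _ _ (by norm_num) (by norm_num)]
            ring_nf
        _ = _ := by ring
    · simp [indicator_of_notMem hz]
  have hsub : {x | 6 * T < ‖∫ y, f (x - y) * g y‖ₑ} ⊆ {x | 4 * T < S x} := by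
    intro x hx
    simp only [mem_ofPred_eq] at hx ⊢
    have h := hx.trans_le (hbound x)
    rw [show (6 : ℝ≥0∞) * T = 4 * T + 2 * T by ring] at h
    exact lt_of_add_lt_add_right h
  refine (measure_mono hsub).trans ?_
  rcases eq_or_ne T 0 with hT0 | hT0
  · have hc0 : ∀ z, c z = 0 := fun z => by
      have := ENNReal.tsum_eq_zero.1 (hT.symm.trans hT0) z
      refine (mul_eq_zero.1 this).resolve_right ?_
      exact (ENNReal.rpow_pos (by norm_num) (by norm_num)).ne'
    have : ∀ x, S x = 0 := fun x => ENNReal.tsum_eq_zero.2 fun z => by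
      by_cases hz : z ∈ P <;> simp [hz, hc0]
    simp [this]
  · have hSm : Measurable S := Measurable.tsum fun z => (hIm z).const_mul _
    have h := (mul_meas_ge_le_lintegral hSm (4 * T)).trans hint
    rw [mul_comm, ENNReal.mul_le_mul_iff_left (by simpa using hT0)
      (ENNReal.mul_ne_top (by norm_num) hTt)] at h
    refine le_trans (measure_mono fun x hx => ?_) h
    simp only [mem_ofPred_eq] at hx ⊢
    exact hx.le

lemma rearr_conv_le {f g : EuclideanSpace ℝ (Fin n) → ℝ} (hf : MemS0 f) (hg : MemS0 g)
    {m : ℤ} {t : ℝ} (ht : 2 ^ m < t) :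
    ENNReal.ofReal (rearr (fun x => ∫ y, f (x - y) * g y) t) ≤ 6 * dyadicMajorant f g m := by
  rcases eq_or_ne (6 * dyadicMajorant f g m) ∞ with h | h
  · simp [h]
  refine ENNReal.ofReal_le_of_le_toReal (_root_.le_of_forall_pos_le_add fun ε hε => ?_)
  refine rearr_le_of_volume_lt (by positivity) (lt_of_le_of_lt ?_
    ((ENNReal.ofReal_lt_ofReal_iff ((by positivity : (0 : ℝ) < 2 ^ m).trans ht)).2 ht))
  rw [ofReal_two_zpow]
  refine (measure_mono fun x hx => ?_).trans (volume_conv_superlevel_le hf hg m)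
  simp only [mem_ofPred_eq] at hx ⊢
  rw [← ofReal_norm, Real.norm_eq_abs]
  exact (ENNReal.lt_ofReal_iff_toReal_lt h).2 ((lt_add_of_pos_right _ hε).trans hx)

end

/-- `(a, b)` is a convex combination of `(1, 0)`, `(0, 1)`, `(1, 1)`. -/
lemma min_le_convex_combination {a b : ℝ} (ha : a ≤ 1) (hb : b ≤ 1) (hab : 1 ≤ a + b) (u v : ℝ) :
    min (min u v) (u + v) ≤ a * u + b * v := by
  set w := min (min u v) (u + v)
  have h1 : w ≤ u := (min_le_left _ _).trans (min_le_left _ _)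
  have h2 : w ≤ v := (min_le_left _ _).trans (min_le_right _ _)
  have h3 : w ≤ u + v := min_le_right _ _
  nlinarith [mul_le_mul_of_nonneg_left h1 (sub_nonneg.2 hb),
    mul_le_mul_of_nonneg_left h2 (sub_nonneg.2 ha), mul_le_mul_of_nonneg_left h3 (sub_nonneg.2 hab)]

lemma exists_min_sub_le_neg_abs {θ η : ℝ} (hθ : θ < 1) (hη : η < 1) (h : 1 < θ + η) :
    ∃ ε : ℝ, 0 < ε ∧ ∀ u v : ℝ,
      min (min u v) (u + v) - θ * u - η * v ≤ -(ε * |u|) + -(ε * |v|) := by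
  obtain ⟨ε, hε, hlt⟩ := exists_between
    (show 0 < min (min (1 - θ) (1 - η)) ((θ + η - 1) / 2) by
      simp only [lt_min_iff]; refine ⟨⟨?_, ?_⟩, ?_⟩ <;> linarith)
  simp only [lt_min_iff] at hlt
  obtain ⟨⟨h1, h2⟩, h3⟩ := hlt
  refine ⟨ε, hε, fun u v => ?_⟩
  rcases abs_cases u with ⟨hu, -⟩ | ⟨hu, -⟩ <;> rcases abs_cases v with ⟨hv, -⟩ | ⟨hv, -⟩ <;>
    rw [hu, hv]
  · linarith [min_le_convex_combination (a := θ - ε) (b := η - ε) (by linarith) (by linarith)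
      (by linarith) u v]
  · linarith [min_le_convex_combination (a := θ - ε) (b := η + ε) (by linarith) (by linarith)
      (by linarith) u v]
  · linarith [min_le_convex_combination (a := θ + ε) (b := η - ε) (by linarith) (by linarith)
      (by linarith) u v]
  · linarith [min_le_convex_combination (a := θ + ε) (b := η + ε) (by linarith) (by linarith)
      (by linarith) u v]

section

variable {n : ℕ}

/-- The normalized dyadic values `2 ^ (k / p) * f*(2 ^ k)`. -/
noncomputable def dyadicCoeff (p : ℝ) (f : EuclideanSpace ℝ (Fin n) → ℝ) (k : ℤ) : ℝ≥0∞ :=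
  2 ^ ((k : ℝ) / p) * dyadicValue f k

lemma two_zpow_rpow (k : ℤ) (x : ℝ) : ((2 : ℝ) ^ k) ^ x = 2 ^ (k * x) := by
  rw [← Real.rpow_intCast, ← Real.rpow_mul (by norm_num)]

lemma MemS0.seqNorm_dyadicCoeff_le {f : EuclideanSpace ℝ (Fin n) → ℝ} (hf : MemS0 f) {p : ℝ}
    (hp : 0 < p) {μ : ℝ≥0∞} (hμ : 0 < μ) :
    seqNorm μ (dyadicCoeff p f) ≤ 2 ^ (1 / p) * (2 ^ (1 / μ.toReal) * lorentzNorm p μ f) := by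
  have h2 : ∀ k : ℤ, dyadicCoeff p f (k + 1) =
      2 ^ (1 / p) * ENNReal.ofReal (((2 : ℝ) ^ k) ^ (1 / p) * rearr f (2 ^ (k + 1))) := fun k => by
    rw [ENNReal.ofReal_mul (by positivity), two_zpow_rpow, ofReal_two_rpow, ← mul_assoc,
      ← ENNReal.rpow_add _ _ (by norm_num) (by norm_num), dyadicCoeff, dyadicValue]
    congr 2
    push_cast
    ring
  rw [← seqNorm_shift μ (dyadicCoeff p f) 1]
  simp_rw [h2]
  rw [seqNorm_const_mul hμ]
  gcongr
  refine seqNorm_le_lorentzNorm p μ f _ fun k t ht => ?_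
  have h0 : (0 : ℝ) < 2 ^ k := by positivity
  have := hf.rearr_antitoneOn (mem_Ioi.2 (h0.trans ht.1)) (mem_Ioi.2 (by positivity)) ht.2
  refine ENNReal.ofReal_le_ofReal (mul_le_mul ?_ this (rearr_nonneg _ _)
    (Real.rpow_nonneg (h0.trans ht.1).le _))
  exact Real.rpow_le_rpow h0.le ht.1.le (by positivity)

lemma rpow_mul_dyadicMajorant_le {p q r ε : ℝ} (hpqr : 1 / p + 1 / q = 1 + 1 / r)
    (hε : ∀ u v : ℝ, min (min u v) (u + v) - 1 / p * u - 1 / q * v ≤ -(ε * |u|) + -(ε * |v|))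
    (f g : EuclideanSpace ℝ (Fin n) → ℝ) (m : ℤ) :
    2 ^ ((m : ℝ) / r) * dyadicMajorant f g m ≤
      (∑' j, dyadicCoeff p f j * decay ε (j - m)) * ∑' k, dyadicCoeff q g k * decay ε (k - m) := by
  rw [dyadicMajorant, ENNReal.tsum_prod', ← ENNReal.tsum_mul_left, ← ENNReal.tsum_mul_right]
  refine ENNReal.tsum_le_tsum fun j => ?_
  rw [← ENNReal.tsum_mul_left, ← ENNReal.tsum_mul_left]
  refine ENNReal.tsum_le_tsum fun k => ?_
  have key : (2 : ℝ≥0∞) ^ ((m : ℝ) / r) * 2 ^ (min (min (j : ℝ) k) (j + k - m)) ≤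
      2 ^ ((j : ℝ) / p) * 2 ^ ((k : ℝ) / q) * (decay ε (j - m) * decay ε (k - m)) := by
    simp only [decay]
    repeat rw [← ENNReal.rpow_add _ _ (by norm_num) (by norm_num)]
    refine ENNReal.rpow_le_rpow_of_exponent_le one_le_two ?_
    have h := hε (j - m) (k - m)
    have hmin : min (min (j - m : ℝ) (k - m)) (j - m + (k - m)) =
        min (min (j : ℝ) k) (j + k - m) - m := by
      rw [← min_sub_sub_right, ← min_sub_sub_right]
      ring_nf
    rw [hmin] at h
    have hr : (m : ℝ) / r = m * (1 / p) + m * (1 / q) - m := by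
      rw [div_eq_mul_one_div, ← sub_eq_iff_eq_add'.2 hpqr]
      ring
    rw [hr, div_eq_mul_one_div (j : ℝ), div_eq_mul_one_div (k : ℝ)]
    push_cast
    linarith
  calc _ = dyadicValue f j * dyadicValue g k *
        (2 ^ ((m : ℝ) / r) * 2 ^ (min (min (j : ℝ) k) (j + k - m))) := by ring
    _ ≤ dyadicValue f j * dyadicValue g k *
        (2 ^ ((j : ℝ) / p) * 2 ^ ((k : ℝ) / q) * (decay ε (j - m) * decay ε (k - m))) := by
        gcongr
    _ = _ := by
        simp only [dyadicCoeff]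
        ring

lemma lorentzNorm_conv_le {f g : EuclideanSpace ℝ (Fin n) → ℝ} (hf : MemS0 f) (hg : MemS0 g)
    {r : ℝ} (hr : 0 < r) {s : ℝ≥0∞} (hs : 0 < s) :
    lorentzNorm r s (fun x => ∫ y, f (x - y) * g y) ≤
      2 ^ (1 / r) * 6 * seqNorm s (fun m => 2 ^ ((m : ℝ) / r) * dyadicMajorant f g m) := by
  rw [← seqNorm_const_mul hs]
  refine lorentzNorm_le_seqNorm r s _ _ fun m t ht => ?_
  have h0 : 0 < t := (by positivity : (0 : ℝ) < 2 ^ m).trans ht.1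
  have h1 : ENNReal.ofReal (t ^ (1 / r)) ≤ 2 ^ (1 / r) * 2 ^ ((m : ℝ) / r) := by
    calc ENNReal.ofReal (t ^ (1 / r)) ≤ ENNReal.ofReal (((2 : ℝ) ^ (m + 1)) ^ (1 / r)) :=
          ENNReal.ofReal_le_ofReal (Real.rpow_le_rpow h0.le ht.2 (by positivity))
      _ = 2 ^ (1 / r) * 2 ^ ((m : ℝ) / r) := by
          rw [two_zpow_rpow, ofReal_two_rpow, ← ENNReal.rpow_add _ _ (by norm_num) (by norm_num)]
          push_cast
          ring_nf
  rw [ENNReal.ofReal_mul (by positivity)]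
  calc _ ≤ (2 ^ (1 / r) * 2 ^ ((m : ℝ) / r)) * (6 * dyadicMajorant f g m) :=
        mul_le_mul' h1 (rearr_conv_le hf hg ht.1)
    _ = _ := by ring

end

/-- **O'Neil–Hunt convolution theorem in Lorentz spaces.** If `1/p + 1/q = 1 + 1/r`
with `1 < p, q, r < ∞` and `1/μ + 1/ν = 1/s` with `0 < μ, ν, s ≤ ∞`, then
`‖f∗g‖_{r,s} ≤ c ‖f‖_{p,μ} ‖g‖_{q,ν}`. -/
theorem oneil_hunt_lorentz_convolution {n : ℕ} (p q r : ℝ) (μ ν s : ℝ≥0∞)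
    (hp : 1 < p) (hq : 1 < q) (hr : 1 < r) (hpqr : 1 / p + 1 / q = 1 + 1 / r)
    (hμ : 0 < μ) (hν : 0 < ν) (hs : 0 < s) (hμνs : μ⁻¹ + ν⁻¹ = s⁻¹) :
    ∃ c : ℝ, 0 < c ∧
      ∀ f g : EuclideanSpace ℝ (Fin n) → ℝ, MemS0 f → MemS0 g →
        lorentzNorm p μ f < ⊤ → lorentzNorm q ν g < ⊤ →
        lorentzNorm r s (fun x => ∫ y, f (x - y) * g y)
          ≤ ENNReal.ofReal c * lorentzNorm p μ f * lorentzNorm q ν g := by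
  have hp0 : 0 < p := by linarith
  have hq0 : 0 < q := by linarith
  have hr0 : 0 < r := by linarith
  obtain ⟨ε, hε, hεuv⟩ := exists_min_sub_le_neg_abs ((div_lt_one hp0).2 hp) ((div_lt_one hq0).2 hq)
    (by rw [hpqr]; linarith [one_div_pos.2 hr0])
  obtain ⟨C₁, hC₁, h₁⟩ := exists_seqNorm_conv_decay_le hε hμ
  obtain ⟨C₂, hC₂, h₂⟩ := exists_seqNorm_conv_decay_le hε hν
  set C : ℝ≥0∞ := 2 ^ (1 / r) * 6 *
    ((C₁ * (2 ^ (1 / p) * 2 ^ (1 / μ.toReal))) * (C₂ * (2 ^ (1 / q) * 2 ^ (1 / ν.toReal)))) with hC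
  have two_rpow_ne_top : ∀ x : ℝ, (2 : ℝ≥0∞) ^ x ≠ ∞ := fun x =>
    ENNReal.rpow_ne_top_of_ne_zero (by norm_num) (by norm_num)
  have hCt : C ≠ ∞ := by
    have := two_rpow_ne_top
    have := hC₁.ne
    have := hC₂.ne
    finiteness
  refine ⟨C.toReal + 1, by positivity, fun f g hf hg _ _ => ?_⟩
  calc lorentzNorm r s (fun x => ∫ y, f (x - y) * g y)
      ≤ 2 ^ (1 / r) * 6 * seqNorm s (fun m => 2 ^ ((m : ℝ) / r) * dyadicMajorant f g m) :=
        lorentzNorm_conv_le hf hg hr0 hs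
    _ ≤ 2 ^ (1 / r) * 6 * (seqNorm μ (fun m => ∑' j, dyadicCoeff p f j * decay ε (j - m)) *
          seqNorm ν (fun m => ∑' k, dyadicCoeff q g k * decay ε (k - m))) := by
        gcongr
        exact (seqNorm_mono s (rpow_mul_dyadicMajorant_le hpqr hεuv f g)).trans
          (seqNorm_mul_le hμ hν hs hμνs _ _)
    _ ≤ 2 ^ (1 / r) * 6 *
          ((C₁ * (2 ^ (1 / p) * (2 ^ (1 / μ.toReal) * lorentzNorm p μ f))) *
            (C₂ * (2 ^ (1 / q) * (2 ^ (1 / ν.toReal) * lorentzNorm q ν g)))) := by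
        gcongr
        · exact (h₁ _).trans (by gcongr; exact hf.seqNorm_dyadicCoeff_le hp0 hμ)
        · exact (h₂ _).trans (by gcongr; exact hg.seqNorm_dyadicCoeff_le hq0 hν)
    _ = C * lorentzNorm p μ f * lorentzNorm q ν g := by
        rw [hC]
        ring
    _ ≤ ENNReal.ofReal (C.toReal + 1) * lorentzNorm p μ f * lorentzNorm q ν g := by
        gcongr
        rw [← ENNReal.ofReal_toReal hCt, ENNReal.toReal_ofReal toReal_nonneg]
        exact ENNReal.ofReal_le_ofReal (by linarith)
end
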